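/- FO_ℤ, PQ2MLO and MTL_ℤ+C all have the same expressive power: for formulas with one free variable, each of the three formalisms can express exactly the same properties of signals. -/

import Mathlib

namespace MTLPaper

variable {K : AddSubgroup ℝ} {P : Type}

/-- `K ⊆ ℝ` is dense: between any two elements of `K` there is another element of `K`. -/
def DenseK (K : AddSubgroup ℝ) : Prop :=
  ∀ a ∈ K, ∀ b ∈ K, a < b → ∃ c ∈ K, a < c ∧ c < b

/-- A term of `FO_K`: a variable index together with a constant shift from `K`
(`(x, c)` denotes the term `x + c`; iterated shifts collapse since `K` is a group). -/
abbrev Term (K : AddSubgroup ℝ) : Type := ℕ × K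

/-- Value of a term under a valuation of the variables. -/
def Term.val (v : ℕ → ℝ) (t : Term K) : ℝ := v t.1 + (t.2 : ℝ)

/-- Formulas of the monadic logic of order and metric `FO_K`, over monadic predicates `P`. -/
inductive FO (K : AddSubgroup ℝ) (P : Type) : Type
  | tt : FO K P
  | atom : P → Term K → FO K P
  | lt : Term K → Term K → FO K P
  | conj : FO K P → FO K P → FO K P
  | neg : FO K P → FO K P
  | ex : ℕ → FO K P → FO K P

namespace FO

/-- Satisfaction of an `FO_K` formula over a signal `f` and a valuation `v`. -/
def sat (f : ℝ → Set P) : FO K P → (ℕ → ℝ) → Prop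
  | tt, _ => True
  | atom p t, v => p ∈ f (Term.val v t)
  | lt s t, v => Term.val v s < Term.val v t
  | conj φ ψ, v => sat f φ v ∧ sat f ψ v
  | neg φ, v => ¬ sat f φ v
  | ex x φ, v => ∃ r : ℝ, sat f φ (Function.update v x r)

/-- Free variables of an `FO_K` formula. -/
def free : FO K P → Set ℕ
  | tt => ∅
  | atom _ t => {t.1}
  | lt s t => {s.1, t.1}
  | conj φ ψ => free φ ∪ free ψ
  | neg φ => free φ
  | ex x φ => free φ \ {x}

/-- Quantifier depth. -/
def qdepth : FO K P → ℕ
  | tt => 0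
  | atom _ _ => 0
  | lt _ _ => 0
  | conj φ ψ => max (qdepth φ) (qdepth ψ)
  | neg φ => qdepth φ
  | ex _ φ => qdepth φ + 1

/-- Quantifier-free formulas. -/
def QFree : FO K P → Prop
  | tt => True
  | atom _ _ => True
  | lt _ _ => True
  | conj φ ψ => QFree φ ∧ QFree ψ
  | neg φ => QFree φ
  | ex _ _ => False

/-- `<`-free formulas. -/
def LtFree : FO K P → Prop
  | tt => True
  | atom _ _ => True
  | lt _ _ => False
  | conj φ ψ => LtFree φ ∧ LtFree ψ
  | neg φ => LtFree φ
  | ex _ φ => LtFree φ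

/-- Membership in `Bet_K(t₁,t₂)`: every quantified subformula `∃z ψ` has the form
`∃z ((t₁ < z < t₂) ∧ χ)`, and every monadic atom `P(t)` has `t` a bound occurrence of a
variable (no shift).  `B` records the set of variables bound so far. -/
def Bet (t₁ t₂ : Term K) : FO K P → Set ℕ → Prop
  | tt, _ => True
  | atom _ t, B => t.2 = (0 : K) ∧ t.1 ∈ B
  | lt _ _, _ => True
  | conj φ ψ, B => Bet t₁ t₂ φ B ∧ Bet t₁ t₂ ψ B
  | neg φ, B => Bet t₁ t₂ φ B
  | ex z (conj (conj (lt s u) (lt u' t)) χ), B =>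
      s = t₁ ∧ t = t₂ ∧ u = (z, (0 : K)) ∧ u' = (z, (0 : K)) ∧ Bet t₁ t₂ χ (insert z B)
  | ex _ _, _ => False

/-- `φ(x)` is `N`-bounded: it belongs to `Bet_K(x - N, x + N)`. -/
def NBounded (x : ℕ) (N : K) (φ : FO K P) : Prop :=
  Bet (x, -N) (x, N) φ (∅ : Set ℕ)

/-- The relativized quantifier `∃ y ∈ (s, t). φ`. -/
def guard (s t : Term K) (y : ℕ) (φ : FO K P) : FO K P :=
  ex y (conj (conj (lt s (y, (0 : K))) (lt (y, (0 : K)) t)) φ)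

/-- The guard interval of the body of a quantifier on `z`, if it has guarded shape. -/
def guardOf (z : ℕ) : FO K P → Set (Term K × Term K)
  | conj (conj (lt s u) (lt u' t)) _ =>
      {p | u = (z, (0 : K)) ∧ u' = (z, (0 : K)) ∧ p = (s, t)}
  | _ => ∅

/-- The guard intervals occurring in a formula. -/
def intervals : FO K P → Set (Term K × Term K)
  | tt => ∅
  | atom _ _ => ∅
  | lt _ _ => ∅
  | conj φ ψ => intervals φ ∪ intervals ψ
  | neg φ => intervals φ
  | ex z φ => guardOf z φ ∪ intervals φ

/-- Hierarchical Interval Formulas (HIFs).  Every `<`-free quantifier-free formula is a HIF;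
HIFs are closed under negation and disjunction (`φ ∨ ψ := ¬(¬φ ∧ ¬ψ)`); and if `φ(x̄, y)` is a
HIF such that the only guard intervals in `φ` involving `y` and a variable free in `φ` are of
the form `(x_l + c_l + c, y + c)` or `(y + c, x_r + c_r + c)` for some `c ∈ K`, then
`∃ y ∈ (x_l + c_l, x_r + c_r). φ` is a HIF. -/
inductive IsHIF : FO K P → Prop
  | base {φ : FO K P} : QFree φ → LtFree φ → IsHIF φ
  | negI {φ : FO K P} : IsHIF φ → IsHIF (neg φ)
  | disjI {φ ψ : FO K P} : IsHIF φ → IsHIF ψ → IsHIF (neg (conj (neg φ) (neg ψ)))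
  | exI {φ : FO K P} {y xl xr : ℕ} {cl cr : K} :
      IsHIF φ → xl ≠ y → xr ≠ y →
      (∀ s t : Term K, (s, t) ∈ intervals φ →
        (s.1 = y → t.1 ≠ y → t.1 ∈ free φ → ∃ c : K, s = (y, c) ∧ t = (xr, cr + c)) ∧
        (t.1 = y → s.1 ≠ y → s.1 ∈ free φ → ∃ c : K, t = (y, c) ∧ s = (xl, cl + c))) →
      IsHIF (guard (xl, cl) (xr, cr) y φ)

/-- A conjunction of constraints of the form `x_j + c < x_k + c'`. -/
def IsConstraintConj : FO K P → Prop
  | tt => True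
  | atom _ _ => False
  | lt _ _ => True
  | conj φ ψ => IsConstraintConj φ ∧ IsConstraintConj ψ
  | neg _ => False
  | ex _ _ => False

/-- The term `t` applies no nonzero shift unless its variable is `x`. -/
def TermOnly (x : ℕ) (t : Term K) : Prop := t.2 = (0 : K) ∨ t.1 = x

/-- The unary functions `+c` are applied only to the variable `x`. -/
def FnOnly (x : ℕ) : FO K P → Prop
  | tt => True
  | atom _ t => TermOnly x t
  | lt s t => TermOnly x s ∧ TermOnly x t
  | conj φ ψ => FnOnly x φ ∧ FnOnly x ψ
  | neg φ => FnOnly x φ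
  | ex _ φ => FnOnly x φ

end FO

/-- Equivalence of two `FO_K` formulas: same truth value for every signal and valuation. -/
def EquivFO (φ ψ : FO K P) : Prop :=
  ∀ (f : ℝ → Set P) (v : ℕ → ℝ), φ.sat f v ↔ ψ.sat f v

/-- An interval `I ⊆ (0,∞)` with endpoints in `K_{≥0} ∪ {∞}` (`hi = none` means `∞`). -/
structure MTLI (K : AddSubgroup ℝ) where
  lo : ℝ
  lo_mem : lo ∈ K
  lo_nonneg : 0 ≤ lo
  loClosed : Bool
  hi : Option ℝ
  hi_mem : ∀ h : ℝ, hi = some h → h ∈ K ∧ 0 ≤ h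
  hiClosed : Bool
  pos : lo = 0 → loClosed = false

namespace MTLI

/-- Membership in the interval. -/
def mem (I : MTLI K) (t : ℝ) : Prop :=
  (if I.loClosed then I.lo ≤ t else I.lo < t) ∧
  ∀ h : ℝ, I.hi = some h → (if I.hiClosed then t ≤ h else t < h)

/-- The interval is bounded. -/
def Bounded (I : MTLI K) : Prop := I.hi ≠ none

/-- The supremum of the interval, in `ℝ ∪ {∞}`. -/
def supW (I : MTLI K) : WithTop ℝ :=
  match I.hi with
  | none => ⊤
  | some h => (h : WithTop ℝ)

/-- The singleton (punctual) interval `{N}`, for `N ∈ K`, `N > 0`. -/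
def single (N : ℝ) (hm : N ∈ K) (h0 : 0 < N) : MTLI K where
  lo := N
  lo_mem := hm
  lo_nonneg := h0.le
  loClosed := true
  hi := some N
  hi_mem := fun h hh => by
    obtain rfl := (Option.some.inj hh).symm
    exact ⟨hm, h0.le⟩
  hiClosed := true
  pos := fun h => absurd h h0.ne'

/-- The unconstrained interval `(0, ∞)`. -/
def full : MTLI K where
  lo := 0
  lo_mem := zero_mem K
  lo_nonneg := le_refl 0
  loClosed := false
  hi := none
  hi_mem := fun _ hh => nomatch hh
  hiClosed := false
  pos := fun _ => rfl

end MTLI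

/-- Formulas of `MTL_K` over atomic propositions `P`. -/
inductive MTL (K : AddSubgroup ℝ) (P : Type) : Type
  | tt : MTL K P
  | atom : P → MTL K P
  | conj : MTL K P → MTL K P → MTL K P
  | neg : MTL K P → MTL K P
  | untl : MTL K P → MTL K P → MTLI K → MTL K P
  | sinc : MTL K P → MTL K P → MTLI K → MTL K P

namespace MTL

/-- Satisfaction of an `MTL_K` formula over a signal, at a point.
`untl φ ψ I` is `φ U_I ψ` and `sinc φ ψ I` is `φ S_I ψ`. -/
def sat (f : ℝ → Set P) : MTL K P → ℝ → Prop
  | tt, _ => True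
  | atom p, r => p ∈ f r
  | conj φ ψ, r => sat f φ r ∧ sat f ψ r
  | neg φ, r => ¬ sat f φ r
  | untl φ ψ I, r =>
      ∃ t : ℝ, r < t ∧ I.mem (t - r) ∧ sat f ψ t ∧ ∀ u, r < u → u < t → sat f φ u
  | sinc φ ψ I, r =>
      ∃ t : ℝ, t < r ∧ I.mem (r - t) ∧ sat f ψ t ∧ ∀ u, t < u → u < r → sat f φ u

/-- All intervals occurring in the temporal operators are bounded. -/
def AllBounded : MTL K P → Prop
  | tt => True
  | atom _ => True
  | conj φ ψ => AllBounded φ ∧ AllBounded ψ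
  | neg φ => AllBounded φ
  | untl φ ψ I => I.Bounded ∧ AllBounded φ ∧ AllBounded ψ
  | sinc φ ψ I => I.Bounded ∧ AllBounded φ ∧ AllBounded ψ

/-- LTL formulas: MTL formulas using only the interval `(0, ∞)`. -/
def IsLTL : MTL K P → Prop
  | tt => True
  | atom _ => True
  | conj φ ψ => IsLTL φ ∧ IsLTL ψ
  | neg φ => IsLTL φ
  | untl φ ψ I => I = MTLI.full ∧ IsLTL φ ∧ IsLTL ψ
  | sinc φ ψ I => I = MTLI.full ∧ IsLTL φ ∧ IsLTL ψ

/-- Future reach. -/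
noncomputable def fr : MTL K P → WithTop ℝ
  | tt => 0
  | atom _ => 0
  | conj φ ψ => max (fr φ) (fr ψ)
  | neg φ => fr φ
  | untl φ ψ I => I.supW + max (fr φ) (fr ψ)
  | sinc φ ψ I => max (fr φ) (WithTop.map (fun x => x - I.lo) (fr ψ))

/-- Past reach. -/
noncomputable def pr : MTL K P → WithTop ℝ
  | tt => 0
  | atom _ => 0
  | conj φ ψ => max (pr φ) (pr ψ)
  | neg φ => pr φ
  | untl φ ψ I => max (pr φ) (WithTop.map (fun x => x - I.lo) (pr ψ))
  | sinc φ ψ I => I.supW + max (pr φ) (pr ψ)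

/-- Boolean combinations of formulas from a class `S`. -/
inductive BC (S : MTL K P → Prop) : MTL K P → Prop
  | base {φ : MTL K P} : S φ → BC S φ
  | negB {φ : MTL K P} : BC S φ → BC S (neg φ)
  | conjB {φ ψ : MTL K P} : BC S φ → BC S ψ → BC S (conj φ ψ)

end MTL

/-- Equivalence of two `MTL_K` formulas. -/
def EquivMTL (φ ψ : MTL K P) : Prop :=
  ∀ (f : ℝ → Set P) (r : ℝ), φ.sat f r ↔ ψ.sat f r

/-- Equivalence of an `FO_K` formula with (at most) free variable `0` and an `MTL_K` formula. -/
def EquivFOMTL (φ : FO K P) (ψ : MTL K P) : Prop :=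
  ∀ (f : ℝ → Set P) (r : ℝ), φ.sat f (fun _ => r) ↔ ψ.sat f r

/-- `MTL_K` and `FO_K` have the same expressive power. -/
def SameExpressive (K : AddSubgroup ℝ) (P : Type) : Prop :=
  (∀ φ : FO K P, φ.free ⊆ {0} → ∃ ψ : MTL K P, EquivFOMTL φ ψ) ∧
  (∀ ψ : MTL K P, ∃ φ : FO K P, φ.free ⊆ {0} ∧ EquivFOMTL φ ψ)

/-- Formulas of `MTL_K` with counting modalities. -/
inductive MTLC (K : AddSubgroup ℝ) (P : Type) : Type
  | tt : MTLC K P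
  | atom : P → MTLC K P
  | conj : MTLC K P → MTLC K P → MTLC K P
  | neg : MTLC K P → MTLC K P
  | untl : MTLC K P → MTLC K P → MTLI K → MTLC K P
  | sinc : MTLC K P → MTLC K P → MTLI K → MTLC K P
  | fcount : ℕ → MTLC K P → MTLC K P
  | pcount : ℕ → MTLC K P → MTLC K P

namespace MTLC

/-- Satisfaction of an `MTL_K+C` formula. -/
def sat (f : ℝ → Set P) : MTLC K P → ℝ → Prop
  | tt, _ => True
  | atom p, r => p ∈ f r
  | conj φ ψ, r => sat f φ r ∧ sat f ψ r
  | neg φ, r => ¬ sat f φ r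
  | untl φ ψ I, r =>
      ∃ t : ℝ, r < t ∧ I.mem (t - r) ∧ sat f ψ t ∧ ∀ u, r < u → u < t → sat f φ u
  | sinc φ ψ I, r =>
      ∃ t : ℝ, t < r ∧ I.mem (r - t) ∧ sat f ψ t ∧ ∀ u, t < u → u < r → sat f φ u
  | fcount n φ, r =>
      ∃ s : Fin n → ℝ, StrictMono s ∧ ∀ i, s i ∈ Set.Ioo r (r + 1) ∧ sat f φ (s i)
  | pcount n φ, r =>
      ∃ s : Fin n → ℝ, StrictMono s ∧ ∀ i, s i ∈ Set.Ioo (r - 1) r ∧ sat f φ (s i)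

end MTLC

/-- The integers, as an additive subgroup of `ℝ`. -/
def intZ : AddSubgroup ℝ := AddSubgroup.zmultiples (1 : ℝ)

/-- Equivalence of an `FO_K` formula with free variable `0` and an `MTL_K+C` formula. -/
def EquivFOMTLC (φ : FO K P) (ψ : MTLC K P) : Prop :=
  ∀ (f : ℝ → Set P) (r : ℝ), φ.sat f (fun _ => r) ↔ ψ.sat f r

/-- Formulas of PQ2MLO: Q2MLO with punctuality. -/
inductive PQ (P : Type) : Type
  | tt : PQ P
  | atom : P → ℕ → PQ P
  | lt : ℕ → ℕ → PQ P
  | conj : PQ P → PQ P → PQ P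
  | neg : PQ P → PQ P
  | ex : ℕ → PQ P → PQ P
  | exFutI : ℕ → ℕ → PQ P → PQ P  -- ∃ y ∈ (x, x+1). ψ
  | exPastI : ℕ → ℕ → PQ P → PQ P -- ∃ y ∈ (x-1, x). ψ
  | exFutP : ℕ → ℕ → PQ P → PQ P  -- ∃ y (y = x+1 ∧ χ)
  | exPastP : ℕ → ℕ → PQ P → PQ P -- ∃ y (y = x-1 ∧ χ)

namespace PQ

/-- Satisfaction of a PQ2MLO formula. -/
def sat (f : ℝ → Set P) : PQ P → (ℕ → ℝ) → Prop
  | tt, _ => True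
  | atom p x, v => p ∈ f (v x)
  | lt x y, v => v x < v y
  | conj φ ψ, v => sat f φ v ∧ sat f ψ v
  | neg φ, v => ¬ sat f φ v
  | ex x φ, v => ∃ r : ℝ, sat f φ (Function.update v x r)
  | exFutI x y ψ, v => ∃ r : ℝ, v x < r ∧ r < v x + 1 ∧ sat f ψ (Function.update v y r)
  | exPastI x y ψ, v => ∃ r : ℝ, v x - 1 < r ∧ r < v x ∧ sat f ψ (Function.update v y r)
  | exFutP x y χ, v => ∃ r : ℝ, r = v x + 1 ∧ sat f χ (Function.update v y r)
  | exPastP x y χ, v => ∃ r : ℝ, r = v x - 1 ∧ sat f χ (Function.update v y r)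

/-- Free variables of a PQ2MLO formula. -/
def free : PQ P → Set ℕ
  | tt => ∅
  | atom _ x => {x}
  | lt x y => {x, y}
  | conj φ ψ => free φ ∪ free ψ
  | neg φ => free φ
  | ex x φ => free φ \ {x}
  | exFutI x y ψ => insert x (free ψ \ {y})
  | exPastI x y ψ => insert x (free ψ \ {y})
  | exFutP x y χ => insert x (free χ \ {y})
  | exPastP x y χ => insert x (free χ \ {y})

/-- Well-formedness: in `∃y∈(x,x+1) ψ` and `∃y∈(x-1,x) ψ` the formula `ψ` has exactly the
free variables `x` and `y`; in `∃y (y = x±1 ∧ χ)` the formula `χ` has exactly the free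
variable `y`. -/
def WF : PQ P → Prop
  | tt => True
  | atom _ _ => True
  | lt _ _ => True
  | conj φ ψ => WF φ ∧ WF ψ
  | neg φ => WF φ
  | ex _ φ => WF φ
  | exFutI x y ψ => x ≠ y ∧ free ψ = {x, y} ∧ WF ψ
  | exPastI x y ψ => x ≠ y ∧ free ψ = {x, y} ∧ WF ψ
  | exFutP x y χ => x ≠ y ∧ free χ = {y} ∧ WF χ
  | exPastP x y χ => x ≠ y ∧ free χ = {y} ∧ WF χ

end PQ

/-- Equivalence of an `FO_ℤ` formula with free variable `0` and a PQ2MLO formula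
with free variable `0`. -/
def EquivFOPQ (φ : FO intZ P) (π : PQ P) : Prop :=
  ∀ (f : ℝ → Set P) (r : ℝ), φ.sat f (fun _ => r) ↔ π.sat f (fun _ => r)

/-- Equivalence of a PQ2MLO formula with free variable `0` and an `MTL_ℤ+C` formula. -/
def EquivPQMTLC (π : PQ P) (ψ : MTLC intZ P) : Prop :=
  ∀ (f : ℝ → Set P) (r : ℝ), π.sat f (fun _ => r) ↔ ψ.sat f r

/-- The singleton interval `{1}` over the integer constants. -/
def oneI : MTLI intZ := MTLI.single 1 (AddSubgroup.mem_zmultiples (1 : ℝ)) one_pos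

/-- The interpretation of the enlarged set of monadic predicates: the predicate `(p, c)`
(i.e. `P^c`) holds at `r` iff `p` holds at `r + c`. -/
def liftSig (K : AddSubgroup ℝ) (f : ℝ → Set P) : ℝ → Set (P × K) :=
  fun r => {pc : P × K | pc.1 ∈ f (r + (pc.2 : ℝ))}

/-- Semantics of a decomposition formula `δ(x,y)`:
`x < y ∧ ∃ z₀ … zₙ (x = z₀ < ⋯ < zₙ = y) ∧ ⋀ φᵢ(zᵢ) ∧ ⋀ ∀u (z_{i-1} < u < z_i → ψᵢ(u))`,
where the `φᵢ`, `ψᵢ` are MTL formulas regarded as unary predicates. -/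
def DecompSat (f : ℝ → Set P) (n : ℕ) (φ ψ : ℕ → MTL K P) (x y : ℝ) : Prop :=
  x < y ∧ ∃ z : ℕ → ℝ, z 0 = x ∧ z n = y ∧ (∀ i < n, z i < z (i + 1)) ∧
    (∀ i, 0 < i → i < n → (φ i).sat f (z i)) ∧
    (∀ i, 0 < i → i ≤ n → ∀ u, z (i - 1) < u → u < z i → (ψ i).sat f u)

/-- Semantics of `δ(x,y)` for abstract unary predicates (no `x < y` conjunct). -/
def Delta (φ ψ : ℕ → ℝ → Prop) (n : ℕ) (x y : ℝ) : Prop :=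
  ∃ z : ℕ → ℝ, z 0 = x ∧ z n = y ∧ (∀ i < n, z i < z (i + 1)) ∧
    (∀ i, 0 < i → i < n → φ i (z i)) ∧
    (∀ i, 0 < i → i ≤ n → ∀ u, z (i - 1) < u → u < z i → ψ i u)

/-- Semantics of `δⱼ(x,y)`: the restriction of `δ` to the first `j` formulas of
`ψ₁, φ₁, ψ₂, φ₂, …, ψₙ`, with `k = ⌈j/2⌉` existential quantifiers after `z₀`. -/
def DeltaJ (φ ψ : ℕ → ℝ → Prop) (j : ℕ) (x y : ℝ) : Prop :=
  ∃ z : ℕ → ℝ, z 0 = x ∧ z ((j + 1) / 2) = y ∧ (∀ i < (j + 1) / 2, z i < z (i + 1)) ∧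
    (∀ i, 0 < i → i ≤ j / 2 → φ i (z i)) ∧
    (∀ i, 0 < i → i ≤ (j + 1) / 2 → ∀ u, z (i - 1) < u → u < z i → ψ i u)

/-- The three kinds of formulas in the separation lemma, for the constant `c`:
`◇_{{N}} θ` with `pr θ < N - c`; `◇⁻_{{N}} θ` with `fr θ < N - c`; and formulas in which
all intervals of temporal operators are bounded. -/
def SepKind (c : ℝ) (χ : MTL K P) : Prop :=
  (∃ (N : ℝ) (hm : N ∈ K) (h0 : 0 < N) (θ : MTL K P),
      χ = MTL.untl MTL.tt θ (MTLI.single N hm h0) ∧ θ.pr < ((N - c : ℝ) : WithTop ℝ)) ∨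
  (∃ (N : ℝ) (hm : N ∈ K) (h0 : 0 < N) (θ : MTL K P),
      χ = MTL.sinc MTL.tt θ (MTLI.single N hm h0) ∧ θ.fr < ((N - c : ℝ) : WithTop ℝ)) ∨
  χ.AllBounded


/-! ### Formulas and definable predicates -/

/-- `MTL_ℤ+C` formulas over the propositions `ℕ`. -/
abbrev Fm : Type := MTLC intZ ℕ

/-- Signals over the propositions `ℕ`. -/
abbrev Sig : Type := ℝ → Set ℕ

namespace MTLC

/-- Disjunction. -/
def disj (φ ψ : MTLC K P) : MTLC K P := neg (conj (neg φ) (neg ψ))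

/-- The unconstrained strict until. -/
def untilF (φ ψ : MTLC K P) : MTLC K P := untl φ ψ MTLI.full

/-- The unconstrained strict since. -/
def sinceF (φ ψ : MTLC K P) : MTLC K P := sinc φ ψ MTLI.full

/-- `φ` holds at points arbitrarily close on the right. -/
def accR (φ : MTLC K P) : MTLC K P := neg (untilF (neg φ) tt)

section
variable {f : ℝ → Set P} {φ ψ : MTLC K P} {r : ℝ}

@[simp] lemma sat_tt : (tt : MTLC K P).sat f r := trivial

@[simp] lemma sat_conj : (conj φ ψ).sat f r ↔ φ.sat f r ∧ ψ.sat f r := Iff.rfl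

@[simp] lemma sat_neg : (neg φ).sat f r ↔ ¬ φ.sat f r := Iff.rfl

@[simp] lemma sat_disj : (disj φ ψ).sat f r ↔ φ.sat f r ∨ ψ.sat f r := by
  simp only [disj, sat_neg, sat_conj]; tauto

@[simp] lemma sat_untilF : (untilF φ ψ).sat f r ↔
    ∃ t, r < t ∧ ψ.sat f t ∧ ∀ u, r < u → u < t → φ.sat f u := by
  simp [untilF, MTLC.sat, MTLI.full, MTLI.mem]

@[simp] lemma sat_sinceF : (sinceF φ ψ).sat f r ↔
    ∃ t, t < r ∧ ψ.sat f t ∧ ∀ u, t < u → u < r → φ.sat f u := by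
  simp [sinceF, MTLC.sat, MTLI.full, MTLI.mem]

@[simp] lemma sat_accR : (accR φ).sat f r ↔ ∀ t, r < t → ∃ u, r < u ∧ u < t ∧ φ.sat f u := by
  simp [accR]

end

lemma sat_untl_oneI {f : Sig} {φ : Fm} {r : ℝ} :
    (untl tt φ oneI).sat f r ↔ φ.sat f (r + 1) := by
  simp only [MTLC.sat, oneI, MTLI.single, MTLI.mem]
  constructor
  · rintro ⟨t, -, ⟨h1, h2⟩, h, -⟩
    have h3 := h2 1 rfl
    simp only [if_true] at h1 h3
    rwa [show r + 1 = t by linarith]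
  · intro h
    refine ⟨r + 1, by linarith, ⟨by simp, fun h hh => ?_⟩, h, fun _ _ _ => trivial⟩
    obtain rfl := Option.some.inj hh
    simp

lemma sat_sinc_oneI {f : Sig} {φ : Fm} {r : ℝ} :
    (sinc tt φ oneI).sat f r ↔ φ.sat f (r - 1) := by
  simp only [MTLC.sat, oneI, MTLI.single, MTLI.mem]
  constructor
  · rintro ⟨t, -, ⟨h1, h2⟩, h, -⟩
    have h3 := h2 1 rfl
    simp only [if_true] at h1 h3
    rwa [show r - 1 = t by linarith]
  · intro h
    refine ⟨r - 1, by linarith, ⟨by simp, fun h hh => ?_⟩, h, fun _ _ _ => trivial⟩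
    obtain rfl := Option.some.inj hh
    simp

lemma exists_shift (c : ℤ) (φ : Fm) : ∃ ψ : Fm, ∀ f r, ψ.sat f r ↔ φ.sat f (r + c) := by
  induction c with
  | zero => exact ⟨φ, by simp⟩
  | succ n ih =>
    obtain ⟨ψ, h⟩ := ih
    refine ⟨untl tt ψ oneI, fun f r => ?_⟩
    rw [sat_untl_oneI, h]
    push_cast
    rw [show r + 1 + (n : ℝ) = r + (n + 1) by ring]
  | pred n ih =>
    obtain ⟨ψ, h⟩ := ih
    refine ⟨sinc tt ψ oneI, fun f r => ?_⟩
    rw [sat_sinc_oneI, h]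
    push_cast
    rw [show r - 1 + -(n : ℝ) = r + (-n - 1) by ring]

/-- The formula expressing `φ` at time `r + c`. -/
noncomputable def shift (c : ℤ) (φ : Fm) : Fm := (exists_shift c φ).choose

@[simp] lemma sat_shift {c : ℤ} {φ : Fm} {f : Sig} {r : ℝ} :
    (shift c φ).sat f r ↔ φ.sat f (r + c) := (exists_shift c φ).choose_spec f r

end MTLC

/-- A property of points of signals is definable if it is expressed by an `MTL_ℤ+C` formula. -/
def Definable (X : Sig → ℝ → Prop) : Prop := ∃ φ : Fm, ∀ f r, φ.sat f r ↔ X f r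

namespace Definable
variable {X Y : Sig → ℝ → Prop}

lemma sat (φ : Fm) : Definable (fun f r => φ.sat f r) := ⟨φ, fun _ _ => Iff.rfl⟩

lemma congr (hX : Definable X) (h : ∀ f r, X f r ↔ Y f r) : Definable Y := by
  obtain ⟨φ, hφ⟩ := hX
  exact ⟨φ, fun f r => (hφ f r).trans (h f r)⟩

lemma not (hX : Definable X) : Definable (fun f r => ¬ X f r) := by
  obtain ⟨φ, hφ⟩ := hX
  exact ⟨.neg φ, fun f r => by simp [hφ]⟩

lemma and (hX : Definable X) (hY : Definable Y) : Definable (fun f r => X f r ∧ Y f r) := by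
  obtain ⟨φ, hφ⟩ := hX
  obtain ⟨ψ, hψ⟩ := hY
  exact ⟨.conj φ ψ, fun f r => by simp [hφ, hψ]⟩

lemma or (hX : Definable X) (hY : Definable Y) : Definable (fun f r => X f r ∨ Y f r) :=
  (hX.not.and hY.not).not.congr fun f r => by tauto

lemma const (p : Prop) : Definable (fun _ _ => p) := by
  by_cases hp : p
  · exact ⟨.tt, fun f r => by simp [hp]⟩
  · exact ⟨.neg .tt, fun f r => by simp [hp]⟩

lemma shift (hX : Definable X) (c : ℤ) : Definable (fun f r => X f (r + c)) := by
  obtain ⟨φ, hφ⟩ := hX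
  exact ⟨.shift c φ, fun f r => by simp [hφ]⟩

lemma exists_mem {ι : Type*} (l : List ι) {Z : ι → Sig → ℝ → Prop}
    (h : ∀ i ∈ l, Definable (Z i)) : Definable (fun f r => ∃ i ∈ l, Z i f r) := by
  induction l with
  | nil => exact (const False).congr fun f r => by simp
  | cons i l ih =>
    exact ((h i (by simp)).or (ih fun j hj => h j (by simp [hj]))).congr fun f r => by simp

end Definable

/-! ### Chains -/

/-- A relation between two points of a signal. -/
abbrev BRel : Type := Sig → ℝ → ℝ → Prop

/-- The decomposition formula with gap and point conditions listed in `l` and last gap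
condition `ψ`, on the open interval `(a, b)`. -/
def Chain (f : Sig) : List (Fm × Fm) → Fm → ℝ → ℝ → Prop
  | [], ψ, a, b => ∀ u, a < u → u < b → ψ.sat f u
  | p :: l, ψ, a, b => ∃ z, a < z ∧ z < b ∧ (∀ u, a < u → u < z → p.1.sat f u) ∧
      p.2.sat f z ∧ Chain f l ψ z b

lemma chain_append {f : Sig} {l l' : List (Fm × Fm)} {ψ θ ψ' : Fm} {a b : ℝ} :
    Chain f (l ++ (ψ, θ) :: l') ψ' a b ↔
      ∃ z, a < z ∧ z < b ∧ Chain f l ψ a z ∧ θ.sat f z ∧ Chain f l' ψ' z b := by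
  induction l generalizing a with
  | nil => simp [Chain]
  | cons p l ih =>
    simp only [List.cons_append, Chain, ih]
    constructor
    · rintro ⟨z, h1, h2, h3, h4, w, h5, h6, h7, h8, h9⟩
      exact ⟨w, h1.trans h5, h6, ⟨z, h1, h5, h3, h4, h7⟩, h8, h9⟩
    · rintro ⟨w, h1, h6, ⟨z, h2, h5, h3, h4, h7⟩, h8, h9⟩
      exact ⟨z, h2, h5.trans h6, h3, h4, w, h5, h6, h7, h8, h9⟩

/-- The ways in which a point `p` can cut a chain: the chain to the left of `p`, the
condition at `p`, and the conditions of the chain to the right of `p`. -/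
def cuts : List (Fm × Fm) → Fm → List ((List (Fm × Fm) × Fm) × Fm × List (Fm × Fm))
  | [], ψ => [(([], ψ), ψ, [])]
  | p :: l, ψ => (([], p.1), p.1, p :: l) :: (([], p.1), p.2, l) ::
      (cuts l ψ).map fun s => ((p :: s.1.1, s.1.2), s.2)

lemma length_of_mem_cuts {l : List (Fm × Fm)} {ψ : Fm}
    {s : (List (Fm × Fm) × Fm) × Fm × List (Fm × Fm)} (h : s ∈ cuts l ψ) :
    s.2.2.length ≤ l.length := by
  induction l generalizing s with
  | nil => simp only [cuts, List.mem_singleton] at h; simp [h]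
  | cons p l ih =>
    simp only [cuts, List.mem_cons, List.mem_map] at h
    rcases h with rfl | rfl | ⟨s, hs, rfl⟩
    · simp
    · simp
    · exact (ih hs).trans (by simp)

lemma chain_iff_cuts {f : Sig} {l : List (Fm × Fm)} {ψ : Fm} {a p b : ℝ} (hap : a < p)
    (hpb : p < b) : Chain f l ψ a b ↔ ∃ s ∈ cuts l ψ,
      Chain f s.1.1 s.1.2 a p ∧ s.2.1.sat f p ∧ Chain f s.2.2 ψ p b := by
  induction l generalizing a with
  | nil =>
    simp only [cuts, List.mem_singleton, exists_eq_left, Chain]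
    constructor
    · exact fun h => ⟨fun u h1 h2 => h u h1 (h2.trans hpb), h p hap hpb,
        fun u h1 h2 => h u (hap.trans h1) h2⟩
    · rintro ⟨h1, h2, h3⟩ u hu hu'
      rcases lt_trichotomy u p with h | rfl | h
      exacts [h1 u hu h, h2, h3 u h hu']
  | cons q l ih =>
    simp only [cuts, List.mem_cons, List.mem_map, or_and_right, exists_or, exists_eq_left]
    constructor
    · rintro ⟨z, h1, h2, h3, h4, h5⟩
      rcases lt_trichotomy z p with h | rfl | h
      · right; right
        obtain ⟨s, hs, h6, h7, h8⟩ := (ih h).1 h5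
        exact ⟨_, ⟨s, hs, rfl⟩, ⟨z, h1, h, h3, h4, h6⟩, h7, h8⟩
      · exact Or.inr (Or.inl ⟨h3, h4, h5⟩)
      · exact Or.inl ⟨fun u h6 h7 => h3 u h6 (h7.trans h), h3 p hap h,
          z, h, h2, fun u h6 h7 => h3 u (hap.trans h6) h7, h4, h5⟩
    · rintro (⟨h1, h2, z, h3, h4, h5, h6, h7⟩ | ⟨h1, h2, h3⟩ |
        ⟨_, ⟨s, hs, rfl⟩, ⟨z, h1, h, h3, h4, h6⟩, h7, h8⟩)
      · refine ⟨z, hap.trans h3, h4, fun u hu hu' => ?_, h6, h7⟩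
        rcases lt_trichotomy u p with h | rfl | h
        exacts [h1 u hu h, h2, h5 u h hu']
      · exact ⟨p, hap, hpb, h1, h2, h3⟩
      · exact ⟨z, h1, h.trans hpb, h3, h4, (ih h).2 ⟨s, hs, h6, h7, h8⟩⟩

lemma chain_map_conj {f : Sig} {l : List (Fm × Fm)} {ψ θ : Fm} {a b : ℝ} (hab : a < b) :
    Chain f (l.map fun p => (.conj θ p.1, .conj θ p.2)) (.conj θ ψ) a b ↔
      (∀ u, a < u → u < b → θ.sat f u) ∧ Chain f l ψ a b := by
  induction l generalizing a with
  | nil => simp only [Chain, List.map_nil, MTLC.sat_conj]; grind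
  | cons p l ih =>
    simp only [Chain, List.map_cons, MTLC.sat_conj]
    constructor
    · rintro ⟨z, h1, h2, h3, h4, h5⟩
      rw [ih h2] at h5
      refine ⟨fun u hu hu' => ?_, z, h1, h2, fun u h6 h7 => (h3 u h6 h7).2, h4.2, h5.2⟩
      rcases lt_trichotomy u z with h | rfl | h
      exacts [(h3 u hu h).1, h4.1, h5.1 u h hu']
    · rintro ⟨h, z, h1, h2, h3, h4, h5⟩
      exact ⟨z, h1, h2, fun u h6 h7 => ⟨h u h6 (h7.trans h2), h3 u h6 h7⟩, ⟨h z h1 h2, h4⟩,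
        (ih h2).2 ⟨fun u h6 h7 => h u (h1.trans h6) h7, h5⟩⟩

lemma chain_map_shift {f : Sig} {l : List (Fm × Fm)} {ψ : Fm} {a b : ℝ} (c : ℤ) :
    Chain f (l.map fun p => (.shift c p.1, .shift c p.2)) (.shift c ψ) a b ↔
      Chain f l ψ (a + c) (b + c) := by
  have key : ∀ (θ : Fm) (a b : ℝ), (∀ u, a < u → u < b → θ.sat f (u + c)) ↔
      ∀ u, a + c < u → u < b + c → θ.sat f u := fun θ a b =>
    ⟨fun h u h1 h2 => by simpa using h (u - c) (by linarith) (by linarith),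
      fun h u h1 h2 => h _ (by linarith) (by linarith)⟩
  induction l generalizing a with
  | nil => simp [Chain, key]
  | cons p l ih =>
    simp only [Chain, List.map_cons, MTLC.sat_shift, ih, key]
    constructor
    · rintro ⟨z, h1, h2, h3⟩
      exact ⟨z + c, by linarith, by linarith, h3⟩
    · rintro ⟨z, h1, h2, h3⟩
      exact ⟨z - c, by linarith, by linarith, by simpa using h3⟩

/-! ### Finite unions of products -/

/-- Finite unions of intersections of a member of `𝒜` with a member of `ℬ`, up to
equivalence on `D`. -/
inductive ProdClass {α : Type} (𝒜 ℬ : (α → Prop) → Prop) (D : α → Prop) : (α → Prop) → Prop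
  | base {A B : α → Prop} : 𝒜 A → ℬ B → ProdClass 𝒜 ℬ D (fun x => A x ∧ B x)
  | or {S T : α → Prop} : ProdClass 𝒜 ℬ D S → ProdClass 𝒜 ℬ D T →
      ProdClass 𝒜 ℬ D (fun x => S x ∨ T x)
  | congr {S T : α → Prop} : ProdClass 𝒜 ℬ D S → (∀ x, D x → (S x ↔ T x)) →
      ProdClass 𝒜 ℬ D T

namespace ProdClass
variable {α : Type} {𝒜 ℬ : (α → Prop) → Prop} {D S T : α → Prop}

lemma and (h𝒜 : ∀ {A B}, 𝒜 A → 𝒜 B → 𝒜 fun x => A x ∧ B x)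
    (hℬ : ∀ {A B}, ℬ A → ℬ B → ℬ fun x => A x ∧ B x)
    (hS : ProdClass 𝒜 ℬ D S) (hT : ProdClass 𝒜 ℬ D T) :
    ProdClass 𝒜 ℬ D fun x => S x ∧ T x := by
  induction hS with
  | base hA hB =>
    induction hT with
    | base hA' hB' => exact (base (h𝒜 hA hA') (hℬ hB hB')).congr fun x _ => by tauto
    | or _ _ ih1 ih2 => exact (ih1.or ih2).congr fun x _ => by tauto
    | congr _ h ih => exact ih.congr fun x hx => by rw [h x hx]
  | or _ _ ih1 ih2 => exact (ih1.or ih2).congr fun x _ => by tauto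
  | congr _ h ih => exact ih.congr fun x hx => by rw [h x hx]

lemma not (h𝒜 : ∀ {A B}, 𝒜 A → 𝒜 B → 𝒜 fun x => A x ∧ B x)
    (hℬ : ∀ {A B}, ℬ A → ℬ B → ℬ fun x => A x ∧ B x)
    (h𝒜' : ∀ {A}, 𝒜 A → 𝒜 fun x => ¬ A x) (hℬ' : ∀ {A}, ℬ A → ℬ fun x => ¬ A x)
    (h𝒜t : 𝒜 fun _ => True) (hℬt : ℬ fun _ => True)
    (hS : ProdClass 𝒜 ℬ D S) : ProdClass 𝒜 ℬ D fun x => ¬ S x := by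
  induction hS with
  | base hA hB =>
    exact ((base (h𝒜' hA) hℬt).or (base h𝒜t (hℬ' hB))).congr fun x _ => by tauto
  | or _ _ ih1 ih2 => exact (and h𝒜 hℬ ih1 ih2).congr fun x _ => by tauto
  | congr _ h ih => exact ih.congr fun x hx => by rw [h x hx]

end ProdClass

/-! ### Decomposable relations -/

/-- Relations that are, on pairs `a < b`, finite disjunctions of decomposition formulas. -/
inductive Dec : BRel → Prop
  | chain (α : Fm) (l : List (Fm × Fm)) (ψ β : Fm) :
      Dec (fun f a b => α.sat f a ∧ Chain f l ψ a b ∧ β.sat f b)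
  | or {R S : BRel} : Dec R → Dec S → Dec (fun f a b => R f a b ∨ S f a b)
  | congr {R S : BRel} : Dec R → (∀ f a b, a < b → (R f a b ↔ S f a b)) → Dec S

/-- A point inside an interval of a signal. -/
structure Cut where
  /-- the signal -/
  sig : Sig
  /-- the left end -/
  a : ℝ
  /-- the point -/
  p : ℝ
  /-- the right end -/
  b : ℝ

/-- Properties of a cut interval which are finite unions of products of decomposable
relations of its two parts. -/
def Split (T : Sig → ℝ → ℝ → ℝ → Prop) : Prop :=
  ProdClass (fun A => ∃ R, Dec R ∧ A = fun x : Cut => R x.sig x.a x.p)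
    (fun B => ∃ R, Dec R ∧ B = fun x : Cut => R x.sig x.p x.b)
    (fun x => x.a < x.p ∧ x.p < x.b) (fun x => T x.sig x.a x.p x.b)

namespace Dec
variable {R S : BRel}

lemma chain' (l : List (Fm × Fm)) (ψ : Fm) : Dec (fun f a b => Chain f l ψ a b) :=
  (chain .tt l ψ .tt).congr fun f a b _ => by simp

lemma all (ψ : Fm) : Dec (fun f a b => ∀ u, a < u → u < b → ψ.sat f u) := chain' [] ψ

lemma left (ψ : Fm) : Dec (fun f a _ => ψ.sat f a) :=
  (chain ψ [] .tt .tt).congr fun f a b _ => by simp [Chain]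

lemma right (ψ : Fm) : Dec (fun f _ b => ψ.sat f b) :=
  (chain .tt [] .tt ψ).congr fun f a b _ => by simp [Chain]

lemma const (p : Prop) : Dec (fun _ _ _ => p) := by
  by_cases hp : p
  · exact (left .tt).congr fun f a b _ => by simp [hp]
  · exact (left (.neg .tt)).congr fun f a b _ => by simp [hp]

lemma and_left (ψ : Fm) (hR : Dec R) : Dec (fun f a b => ψ.sat f a ∧ R f a b) := by
  induction hR with
  | chain α l θ β => exact (chain (.conj ψ α) l θ β).congr fun f a b _ => by simp [and_assoc]
  | or _ _ ih1 ih2 => exact (ih1.or ih2).congr fun f a b _ => by tauto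
  | congr _ h ih => exact ih.congr fun f a b hab => by rw [h f a b hab]

lemma and_right (ψ : Fm) (hR : Dec R) : Dec (fun f a b => R f a b ∧ ψ.sat f b) := by
  induction hR with
  | chain α l θ β => exact (chain α l θ (.conj β ψ)).congr fun f a b _ => by simp [and_assoc]
  | or _ _ ih1 ih2 => exact (ih1.or ih2).congr fun f a b _ => by tauto
  | congr _ h ih => exact ih.congr fun f a b hab => by rw [h f a b hab]

lemma and_all (ψ : Fm) (hR : Dec R) :
    Dec (fun f a b => (∀ u, a < u → u < b → ψ.sat f u) ∧ R f a b) := by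
  induction hR with
  | chain α l θ β =>
    refine (chain α (l.map fun p => (.conj ψ p.1, .conj ψ p.2)) (.conj ψ θ) β).congr
      fun f a b hab => ?_
    rw [chain_map_conj hab]; tauto
  | or _ _ ih1 ih2 => exact (ih1.or ih2).congr fun f a b _ => by tauto
  | congr _ h ih => exact ih.congr fun f a b hab => by rw [h f a b hab]

lemma shift (hR : Dec R) (c : ℤ) : Dec (fun f a b => R f (a + c) (b + c)) := by
  induction hR with
  | chain α l θ β =>
    refine (chain (.shift c α) (l.map fun p => (.shift c p.1, .shift c p.2)) (.shift c θ)
      (.shift c β)).congr fun f a b _ => ?_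
    rw [chain_map_shift]; simp
  | or _ _ ih1 ih2 => exact ih1.or ih2
  | congr _ h ih => exact ih.congr fun f a b hab => h _ _ _ (by linarith)

/-- Decomposable relations are closed under concatenation. -/
lemma cat (hR : Dec R) (hS : Dec S) :
    Dec (fun f a b => ∃ z, a < z ∧ z < b ∧ R f a z ∧ S f z b) := by
  induction hR with
  | chain α l ψ β =>
    induction hS with
    | chain α' l' ψ' β' =>
      refine (chain α (l ++ (ψ, .conj β α') :: l') ψ' β').congr fun f a b _ => ?_
      simp only [chain_append, MTLC.sat_conj]
      constructor
      · rintro ⟨h, ⟨z, h1, h2, h3, h4, h5⟩, h6⟩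
        exact ⟨z, h1, h2, ⟨h, h3, h4.1⟩, h4.2, h5, h6⟩
      · rintro ⟨z, h1, h2, ⟨h, h3, h4⟩, h4', h5, h6⟩
        exact ⟨h, ⟨z, h1, h2, h3, ⟨h4, h4'⟩, h5⟩, h6⟩
    | or _ _ ih1 ih2 =>
      refine (ih1.or ih2).congr fun f a b _ => ?_
      simp only [← exists_or, ← and_or_left]
    | congr _ h ih =>
      refine ih.congr fun f a b _ => exists_congr fun z => and_congr_right fun _ =>
        and_congr_right fun h2 => ?_
      rw [h f z b h2]
  | or _ _ ih1 ih2 =>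
    refine (ih1.or ih2).congr fun f a b _ => ?_
    simp only [← exists_or, ← and_or_left, ← or_and_right]
  | congr _ h ih =>
    refine ih.congr fun f a b _ => exists_congr fun z => and_congr_right fun h1 => ?_
    rw [h f a z h1]

end Dec

namespace Split
variable {T T' : Sig → ℝ → ℝ → ℝ → Prop}

lemma base {R S : BRel} (hR : Dec R) (hS : Dec S) :
    Split (fun f a p b => R f a p ∧ S f p b) :=
  ProdClass.base ⟨R, hR, rfl⟩ ⟨S, hS, rfl⟩

lemma or (h : Split T) (h' : Split T') : Split (fun f a p b => T f a p b ∨ T' f a p b) :=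
  ProdClass.or h h'

lemma congr (h : Split T) (h' : ∀ f a p b, a < p → p < b → (T f a p b ↔ T' f a p b)) :
    Split T' :=
  ProdClass.congr h fun _ hx => h' _ _ _ _ hx.1 hx.2

lemma induction {M : (Sig → ℝ → ℝ → ℝ → Prop) → Prop}
    (hbase : ∀ {R S}, Dec R → Dec S → M fun f a p b => R f a p ∧ S f p b)
    (hor : ∀ {T T'}, M T → M T' → M fun f a p b => T f a p b ∨ T' f a p b)
    (hcongr : ∀ {T T'}, M T → (∀ f a p b, a < p → p < b → (T f a p b ↔ T' f a p b)) → M T')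
    (h : Split T) : M T := by
  have key : ∀ A : Cut → Prop, ProdClass (fun A => ∃ R, Dec R ∧ A = fun x : Cut => R x.sig x.a x.p)
    (fun B => ∃ R, Dec R ∧ B = fun x : Cut => R x.sig x.p x.b)
    (fun x => x.a < x.p ∧ x.p < x.b) A → M fun f a p b => A ⟨f, a, p, b⟩ := by
    intro A hA
    induction hA with
    | base hA hB =>
      obtain ⟨R, hR, rfl⟩ := hA
      obtain ⟨S, hS, rfl⟩ := hB
      exact hbase hR hS
    | or _ _ ih1 ih2 => exact hor ih1 ih2
    | congr _ h ih => exact hcongr ih fun f a p b h1 h2 => h ⟨f, a, p, b⟩ ⟨h1, h2⟩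
  exact key _ h

lemma exists_mem {ι : Type*} (l : List ι) {Z : ι → Sig → ℝ → ℝ → ℝ → Prop}
    (h : ∀ i ∈ l, Split (Z i)) : Split (fun f a p b => ∃ i ∈ l, Z i f a p b) := by
  induction l with
  | nil => exact (base (.const False) (.const False)).congr fun f a p b _ _ => by simp
  | cons i l ih =>
    exact ((h i (by simp)).or (ih fun j hj => h j (by simp [hj]))).congr
      fun f a p b _ _ => by simp

/-- A decomposable relation decomposes at every intermediate point. -/
lemma of_dec {R : BRel} (hR : Dec R) : Split (fun f a _ b => R f a b) := by
  induction hR with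
  | chain α l ψ β =>
    refine (exists_mem (cuts l ψ) (Z := fun s f a p b =>
      (α.sat f a ∧ Chain f s.1.1 s.1.2 a p ∧ s.2.1.sat f p) ∧
      (MTLC.tt.sat f p ∧ Chain f s.2.2 ψ p b ∧ β.sat f b)) fun s _ =>
        base (.chain _ _ _ _) (.chain _ _ _ _)).congr fun f a p b h1 h2 => ?_
    beta_reduce
    rw [chain_iff_cuts h1 h2]
    constructor
    · rintro ⟨s, hs, ⟨h3, h4, h5⟩, -, h6, h7⟩
      exact ⟨h3, ⟨s, hs, h4, h5, h6⟩, h7⟩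
    · rintro ⟨h3, ⟨s, hs, h4, h5, h6⟩, h7⟩
      exact ⟨s, hs, ⟨h3, h4, h5⟩, trivial, h6, h7⟩
  | or _ _ ih1 ih2 => exact ih1.or ih2
  | congr _ h ih => exact ih.congr fun f a p b h1 h2 => h f a b (h1.trans h2)

/-- Projection of the intermediate point. -/
lemma exists_dec (hT : Split T) :
    Dec (fun f a b => ∃ p, a < p ∧ p < b ∧ T f a p b) := by
  refine hT.induction (M := fun T => Dec (fun f a b => ∃ p, a < p ∧ p < b ∧ T f a p b))
    (fun hR hS => hR.cat hS) (fun h1 h2 => (h1.or h2).congr fun f a b _ => ?_)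
    (fun h1 h2 => h1.congr fun f a b _ => exists_congr fun p => ?_)
  · simp only [← exists_or, ← and_or_left]
  · exact and_congr_right fun h3 => and_congr_right fun h4 => h2 f a p b h3 h4

end Split

namespace Dec
variable {R S : BRel}

lemma chain_and (l : List (Fm × Fm)) (ψ : Fm) (hR : Dec R) :
    Dec (fun f a b => Chain f l ψ a b ∧ R f a b) := by
  induction l generalizing R with
  | nil => exact hR.and_all ψ
  | cons q l ih =>
    have key : ∀ {T : Sig → ℝ → ℝ → ℝ → Prop}, Split T →
        Dec (fun f a b => ∃ z, a < z ∧ z < b ∧ ((∀ u, a < u → u < z → q.1.sat f u) ∧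
          q.2.sat f z ∧ Chain f l ψ z b) ∧ T f a z b) := by
      intro T hT
      refine hT.induction (M := fun T => Dec (fun f a b => ∃ z, a < z ∧ z < b ∧
        ((∀ u, a < u → u < z → q.1.sat f u) ∧ q.2.sat f z ∧ Chain f l ψ z b) ∧ T f a z b))
        (fun hR hS => ?_) (fun h1 h2 => (h1.or h2).congr fun f a b _ => ?_)
        (fun h1 h2 => h1.congr fun f a b _ => exists_congr fun p => ?_)
      · refine ((hR.and_all q.1).cat ((ih hS).and_left q.2)).congr fun f a b _ =>
          exists_congr fun z => ?_
        tauto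
      · simp only [← exists_or, ← and_or_left]
      · refine and_congr_right fun h3 => and_congr_right fun h4 => and_congr_right fun _ => ?_
        exact h2 f a p b h3 h4
    refine (key (Split.of_dec hR)).congr fun f a b _ => ?_
    simp only [Chain]
    constructor
    · rintro ⟨z, h1, h2, ⟨h3, h4, h5⟩, h6⟩
      exact ⟨⟨z, h1, h2, h3, h4, h5⟩, h6⟩
    · rintro ⟨⟨z, h1, h2, h3, h4, h5⟩, h6⟩
      exact ⟨z, h1, h2, ⟨h3, h4, h5⟩, h6⟩

/-- Decomposable relations are closed under conjunction. -/
lemma and (hR : Dec R) (hS : Dec S) : Dec (fun f a b => R f a b ∧ S f a b) := by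
  induction hR with
  | chain α l ψ β =>
    exact (((chain_and l ψ hS).and_left α).and_right β).congr fun f a b _ => by tauto
  | or _ _ ih1 ih2 => exact (ih1.or ih2).congr fun f a b _ => by tauto
  | congr _ h ih => exact ih.congr fun f a b hab => by rw [h f a b hab]

end Dec

namespace Split
variable {T T' : Sig → ℝ → ℝ → ℝ → Prop}

lemma and (h : Split T) (h' : Split T') : Split (fun f a p b => T f a p b ∧ T' f a p b) := by
  refine ProdClass.and ?_ ?_ h h'
  · rintro _ _ ⟨R, hR, rfl⟩ ⟨S, hS, rfl⟩
    exact ⟨_, hR.and hS, rfl⟩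
  · rintro _ _ ⟨R, hR, rfl⟩ ⟨S, hS, rfl⟩
    exact ⟨_, hR.and hS, rfl⟩

lemma forall_mem {ι : Type*} (l : List ι) {Z : ι → Sig → ℝ → ℝ → ℝ → Prop}
    (h : ∀ i ∈ l, Split (Z i)) : Split (fun f a p b => ∀ i ∈ l, Z i f a p b) := by
  induction l with
  | nil => exact (base (.const True) (.const True)).congr fun f a p b _ _ => by simp
  | cons i l ih =>
    exact ((h i (by simp)).and (ih fun j hj => h j (by simp [hj]))).congr
      fun f a p b _ _ => by simp

lemma left {R : BRel} (hR : Dec R) : Split (fun f a p _ => R f a p) :=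
  (base hR (.const True)).congr fun f a p b _ _ => by simp

lemma right {R : BRel} (hR : Dec R) : Split (fun f _ p b => R f p b) :=
  (base (.const True) hR).congr fun f a p b _ _ => by simp

end Split

/-! ### Increasing sequences of events -/

/-- There are points `z₁ < z₂ < ⋯` in `(a, b)` satisfying the successive formulas of a list. -/
def Inc (f : Sig) : List Fm → ℝ → ℝ → Prop
  | [], _, _ => True
  | F :: l, a, b => ∃ z, a < z ∧ z < b ∧ F.sat f z ∧ Inc f l z b

section Inc
variable {f : Sig} {F : Fm} {l : List Fm} {a b r : ℝ}

lemma Inc.mono {a' b' : ℝ} (h : Inc f l a b) (ha : a' ≤ a) (hb : b ≤ b') : Inc f l a' b' := by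
  induction l generalizing a a' with
  | nil => trivial
  | cons F l ih =>
    obtain ⟨z, h1, h2, h3, h4⟩ := h
    exact ⟨z, ha.trans_lt h1, h2.trans_le hb, h3, ih h4 le_rfl⟩

/-- The formula `F` holds at the point or at points accumulating on its right. -/
def MTLC.onset (F : MTLC K P) : MTLC K P := .disj F (.accR F)

@[simp] lemma MTLC.sat_onset {f : ℝ → Set P} {F : MTLC K P} :
    F.onset.sat f r ↔ F.sat f r ∨ ∀ t, r < t → ∃ u, r < u ∧ u < t ∧ F.sat f u := by
  simp [MTLC.onset]

lemma exists_onset (h : ∃ z, a < z ∧ z < b ∧ F.sat f z) :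
    F.accR.sat f a ∨
      ∃ r, a < r ∧ r < b ∧ (∀ u, a < u → u < r → ¬ F.sat f u) ∧ F.onset.sat f r := by
  by_cases hacc : F.accR.sat f a
  · exact Or.inl hacc
  right
  simp only [MTLC.sat_accR, not_forall, not_exists, not_and] at hacc
  obtain ⟨t, hat, ht⟩ := hacc
  obtain ⟨z, h1, h2, h3⟩ := h
  set s := {z | a < z ∧ F.sat f z}
  have hbdd : BddBelow s := ⟨a, fun x hx => hx.1.le⟩
  have hne : s.Nonempty := ⟨z, h1, h3⟩
  have htr : t ≤ sInf s := le_csInf hne fun x hx => by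
    by_contra! hlt
    exact ht x hx.1 hlt hx.2
  refine ⟨sInf s, hat.trans_le htr, (csInf_le hbdd ⟨h1, h3⟩).trans_lt h2, fun u hu hu' hF => ?_,
    ?_⟩
  · exact absurd (csInf_le hbdd ⟨hu, hF⟩) (not_le.2 hu')
  · rw [MTLC.sat_onset]
    by_cases hF : F.sat f (sInf s)
    · exact Or.inl hF
    · refine Or.inr fun t' ht' => ?_
      obtain ⟨u, hu, hut⟩ := exists_lt_of_csInf_lt hne ht'
      refine ⟨u, lt_of_le_of_ne (csInf_le hbdd hu) ?_, hut, hu.2⟩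
      rintro h
      exact hF (h ▸ hu.2)

lemma Inc.exists_gt (h : Inc f l a b) (hl : l ≠ []) :
    ∃ a' b', a < a' ∧ a' < b' ∧ b' < b ∧ Inc f l a' b' := by
  induction l generalizing a with
  | nil => exact absurd rfl hl
  | cons F l ih =>
    obtain ⟨z, h1, h2, h3, h4⟩ := h
    obtain ⟨a', ha1, ha2⟩ := exists_between h1
    by_cases hl' : l = []
    · subst hl'
      obtain ⟨b', hb1, hb2⟩ := exists_between h2
      exact ⟨a', b', ha1, ha2.trans hb1, hb2, z, ha2, hb1, h3, trivial⟩
    · obtain ⟨c, b', hc1, hc2, hc3, hc4⟩ := ih h4 hl'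
      exact ⟨a', b', ha1, ha2.trans (hc1.trans hc2), hc3, z, ha2, hc1.trans hc2, h3,
        hc4.mono hc1.le le_rfl⟩

lemma inc_cons_of_accR (hF : F.accR.sat f a) (hab : a < b) :
    Inc f (F :: l) a b ↔ Inc f l a b := by
  rw [MTLC.sat_accR] at hF
  constructor
  · rintro ⟨z, h1, h2, h3, h4⟩
    exact h4.mono h1.le le_rfl
  · intro h
    by_cases hl : l = []
    · obtain ⟨z, h1, h2, h3⟩ := hF b hab
      subst hl
      exact ⟨z, h1, h2, h3, trivial⟩
    · obtain ⟨a', b', h1, h2, h3, h4⟩ := h.exists_gt hl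
      obtain ⟨z, h5, h6, h7⟩ := hF a' h1
      exact ⟨z, h5, h6.trans (h2.trans h3), h7, h4.mono h6.le h3.le⟩

lemma inc_cons_of_onset (har : a < r) (hrb : r < b) (hno : ∀ u, a < u → u < r → ¬ F.sat f u)
    (hF : F.onset.sat f r) : Inc f (F :: l) a b ↔ Inc f l r b := by
  constructor
  · rintro ⟨z, h1, h2, h3, h4⟩
    exact h4.mono (not_lt.1 fun h => hno z h1 h h3) le_rfl
  · intro h
    rcases MTLC.sat_disj.1 hF with hF | hF
    · exact ⟨r, har, hrb, hF, h⟩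
    · exact ((inc_cons_of_accR hF hrb).2 h).mono har.le le_rfl

lemma not_inc_cons (hbr : b ≤ r) (hno : ∀ u, a < u → u < r → ¬ F.sat f u) :
    ¬ Inc f (F :: l) a b := by
  rintro ⟨z, h1, h2, h3, -⟩
  exact hno z h1 (h2.trans_le hbr) h3

end Inc

namespace Dec

lemma inc (l : List Fm) : Dec (fun f a b => Inc f l a b) := by
  induction l with
  | nil => exact const True
  | cons F l ih =>
    exact ((right F).cat ih).congr fun _ _ _ _ => Iff.rfl

lemma not_inc (l : List Fm) : Dec (fun f a b => ¬ Inc f l a b) := by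
  induction l with
  | nil => exact (const False).congr fun f a b _ => by simp [Inc]
  | cons F l ih =>
    refine ((all (.neg F)).or ((ih.and_left F.accR).or
      ((((all (.neg F)).and_right F.onset)).cat ih))).congr fun f a b hab => ?_
    simp only [MTLC.sat_neg]
    constructor
    · rintro (h | ⟨h1, h2⟩ | ⟨r, h1, h2, ⟨h3, h4⟩, h5⟩)
      · exact not_inc_cons le_rfl h
      · rwa [inc_cons_of_accR h1 hab]
      · rwa [inc_cons_of_onset h1 h2 h3 h4]
    · intro h
      by_cases hz : ∃ z, a < z ∧ z < b ∧ F.sat f z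
      · right
        rcases exists_onset hz with h1 | ⟨r, h1, h2, h3, h4⟩
        · exact Or.inl ⟨h1, by rwa [inc_cons_of_accR h1 hab] at h⟩
        · exact Or.inr ⟨r, h1, h2, ⟨h3, h4⟩, by rwa [inc_cons_of_onset h1 h2 h3 h4] at h⟩
      · left
        intro u h1 h2 h3
        exact hz ⟨u, h1, h2, h3⟩

end Dec

/-! ### Chains starting at an unspecified point -/

/-- The formula holding at `b` when some point `a < b` satisfies `B` and starts a chain up
to `b`. -/
def sinceChain : Fm → List (Fm × Fm) → Fm → Fm
  | B, [], ψ => .sinceF ψ B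
  | B, p :: l, ψ => sinceChain (.conj p.2 (.sinceF p.1 B)) l ψ

/-- The conditions satisfied by the points of a chain started by `B`. -/
def stages : Fm → List (Fm × Fm) → List Fm
  | B, [] => [B]
  | B, p :: l => B :: stages (.conj p.2 (.sinceF p.1 B)) l

lemma sat_sinceChain {f : Sig} {B : Fm} {l : List (Fm × Fm)} {ψ : Fm} {b : ℝ} :
    (sinceChain B l ψ).sat f b ↔ ∃ a, a < b ∧ B.sat f a ∧ Chain f l ψ a b := by
  induction l generalizing B with
  | nil => simp [sinceChain, Chain]
  | cons p l ih =>
    simp only [sinceChain, ih, Chain, MTLC.sat_conj, MTLC.sat_sinceF]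
    constructor
    · rintro ⟨z, h1, ⟨h2, a, h3, h4, h5⟩, h6⟩
      exact ⟨a, h3.trans h1, h4, z, h3, h1, h5, h2, h6⟩
    · rintro ⟨a, h, h4, z, h3, h1, h5, h2, h6⟩
      exact ⟨z, h1, ⟨h2, a, h3, h4, h5⟩, h6⟩

lemma exists_chain_iff {f : Sig} {B : Fm} {l : List (Fm × Fm)} {ψ : Fm} {a b : ℝ} :
    (∃ z, a < z ∧ z < b ∧ B.sat f z ∧ Chain f l ψ z b) ↔
      (sinceChain B l ψ).sat f b ∧ Inc f (stages B l) a b := by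
  induction l generalizing a B with
  | nil =>
    simp only [sinceChain, stages, Inc, Chain, MTLC.sat_sinceF, and_true]
    constructor
    · rintro ⟨z, h1, h2, h3, h4⟩
      exact ⟨⟨z, h2, h3, h4⟩, z, h1, h2, h3⟩
    · rintro ⟨⟨w, h1, h2, h3⟩, z, h4, h5, h6⟩
      rcases le_or_gt z w with h | h
      · exact ⟨w, h4.trans_le h, h1, h2, h3⟩
      · exact ⟨z, h4, h5, h6, fun u hu hu' => h3 u (h.trans hu) hu'⟩
  | cons p l ih =>
    simp only [sinceChain, stages, Inc, Chain]
    constructor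
    · rintro ⟨z, h1, h2, h3, w, h4, h5, h6, h7, h8⟩
      have h9 := (ih (a := z)).1 ⟨w, h4, h5, MTLC.sat_conj.2 ⟨h7, MTLC.sat_sinceF.2 ⟨z, h4, h3, h6⟩⟩, h8⟩
      exact ⟨h9.1, z, h1, h2, h3, h9.2⟩
    · rintro ⟨h1, z, h2, h3, h4, h5⟩
      obtain ⟨w, h6, h7, h8, h9⟩ := ih.2 ⟨h1, h5⟩
      simp only [MTLC.sat_conj, MTLC.sat_sinceF] at h8
      obtain ⟨h8, t, h10, h11, h12⟩ := h8
      rcases le_or_gt z t with h | h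
      · exact ⟨t, h2.trans_le h, h10.trans h7, h11, w, h10, h7, h12, h8, h9⟩
      · exact ⟨z, h2, h3, h4, w, h6, h7, fun u hu hu' => h12 u (h.trans hu) hu', h8, h9⟩

lemma Dec.not_exists_chain (B : Fm) (l : List (Fm × Fm)) (ψ : Fm) :
    Dec (fun f a b => ¬ ∃ z, a < z ∧ z < b ∧ B.sat f z ∧ Chain f l ψ z b) := by
  refine ((Dec.right (.neg (sinceChain B l ψ))).or (Dec.not_inc (stages B l))).congr
    fun f a b _ => ?_
  rw [exists_chain_iff, MTLC.sat_neg]; tauto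

lemma Dec.exists_chain (B : Fm) (l : List (Fm × Fm)) (ψ : Fm) :
    Dec (fun f a b => ∃ z, a < z ∧ z < b ∧ B.sat f z ∧ Chain f l ψ z b) :=
  ((Dec.right B).cat (Dec.chain' l ψ)).congr fun _ _ _ _ => Iff.rfl

/-! ### Closure under complement -/

lemma chain_cons_iff_of_onset {f : Sig} {p : Fm × Fm} {l : List (Fm × Fm)} {ψ : Fm} {a b q : ℝ}
    (h1 : a < q) (h2 : q < b) (h3 : ∀ u, a < u → u < q → p.1.sat f u)
    (h4 : (MTLC.neg p.1).onset.sat f q) :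
    Chain f (p :: l) ψ a b ↔ (p.2.sat f q ∧ Chain f l ψ q b) ∨ ∃ s ∈ cuts l ψ,
      (∃ z, a < z ∧ z < q ∧ p.2.sat f z ∧ Chain f s.1.1 s.1.2 z q) ∧
        s.2.1.sat f q ∧ Chain f s.2.2 ψ q b := by
  constructor
  · rintro ⟨z, h5, h6, h7, h8, h9⟩
    rcases lt_trichotomy z q with h | rfl | h
    · obtain ⟨s, hs, h10, h11⟩ := (chain_iff_cuts h h2).1 h9
      exact Or.inr ⟨s, hs, ⟨z, h5, h, h8, h10⟩, h11⟩
    · exact Or.inl ⟨h8, h9⟩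
    · exfalso
      rw [MTLC.sat_onset] at h4
      rcases h4 with h4 | h4
      · exact h4 (h7 q h1 h)
      · obtain ⟨u, hu, hu', h10⟩ := h4 z h
        exact h10 (h7 u (h1.trans hu) hu')
  · rintro (⟨h5, h6⟩ | ⟨s, hs, ⟨z, h5, h6, h7, h8⟩, h9⟩)
    · exact ⟨q, h1, h2, h3, h5, h6⟩
    · exact ⟨z, h5, h6.trans h2, fun u hu hu' => h3 u hu (hu'.trans h6), h7,
        (chain_iff_cuts h6 h2).2 ⟨s, hs, h8, h9⟩⟩

lemma not_chain_cons_iff {f : Sig} {p : Fm × Fm} {l : List (Fm × Fm)} {ψ : Fm} {a b : ℝ} :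
    ¬ Chain f (p :: l) ψ a b ↔ (MTLC.neg p.1).accR.sat f a ∨
      ((∀ u, a < u → u < b → p.1.sat f u) ∧
        ¬ ∃ z, a < z ∧ z < b ∧ p.2.sat f z ∧ Chain f l ψ z b) ∨
      ∃ q, a < q ∧ q < b ∧ ((∀ u, a < u → u < q → p.1.sat f u) ∧
        (MTLC.neg p.1).onset.sat f q ∧ (¬ p.2.sat f q ∨ ¬ Chain f l ψ q b) ∧
        ∀ s ∈ cuts l ψ, (¬ ∃ z, a < z ∧ z < q ∧ p.2.sat f z ∧ Chain f s.1.1 s.1.2 z q) ∨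
          ¬ s.2.1.sat f q ∨ ¬ Chain f s.2.2 ψ q b) := by
  have conv : ∀ q, (¬ ((p.2.sat f q ∧ Chain f l ψ q b) ∨ ∃ s ∈ cuts l ψ,
        (∃ z, a < z ∧ z < q ∧ p.2.sat f z ∧ Chain f s.1.1 s.1.2 z q) ∧
          s.2.1.sat f q ∧ Chain f s.2.2 ψ q b)) ↔ (¬ p.2.sat f q ∨ ¬ Chain f l ψ q b) ∧
        ∀ s ∈ cuts l ψ, (¬ ∃ z, a < z ∧ z < q ∧ p.2.sat f z ∧ Chain f s.1.1 s.1.2 z q) ∨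
          ¬ s.2.1.sat f q ∨ ¬ Chain f s.2.2 ψ q b := by
    intro q
    rw [not_or, not_and_or, not_exists]
    refine and_congr_right fun _ => forall_congr' fun s => ?_
    rw [not_and, not_and_or, not_and_or]
  constructor
  · intro h
    by_cases hall : ∀ u, a < u → u < b → p.1.sat f u
    · refine Or.inr (Or.inl ⟨hall, ?_⟩)
      rintro ⟨z, h1, h2, h3⟩
      exact h ⟨z, h1, h2, fun u hu hu' => hall u hu (hu'.trans h2), h3⟩
    · push Not at hall
      rcases exists_onset (F := .neg p.1) (f := f) hall with h1 | ⟨q, h1, h2, h3, h4⟩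
      · exact Or.inl h1
      · have h3' : ∀ u, a < u → u < q → p.1.sat f u := fun u hu hu' => by
          simpa using h3 u hu hu'
        rw [chain_cons_iff_of_onset h1 h2 h3' h4, conv] at h
        exact Or.inr (Or.inr ⟨q, h1, h2, h3', h4, h⟩)
  · rintro (h | ⟨h1, h2⟩ | ⟨q, h1, h2, h3, h4, h5⟩)
    · rintro ⟨z, h1, h2, h3, h4⟩
      rw [MTLC.sat_accR] at h
      obtain ⟨u, h5, h6, h7⟩ := h z h1
      exact h7 (h3 u h5 h6)
    · rintro ⟨z, h3, h4, -, h5⟩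
      exact h2 ⟨z, h3, h4, h5⟩
    · rwa [chain_cons_iff_of_onset h1 h2 h3 h4, conv]

namespace Dec

lemma not_chain (l : List (Fm × Fm)) (ψ : Fm) : Dec (fun f a b => ¬ Chain f l ψ a b) := by
  induction hn : l.length using Nat.strong_induction_on generalizing l with
  | _ n ih =>
    cases l with
    | nil =>
      refine ((right (.neg ψ)).cat (const True)).congr fun f a b _ => ?_
      simp [Chain]
    | cons p l =>
      have ih' : ∀ l' : List (Fm × Fm), l'.length ≤ l.length →
          Dec (fun f a b => ¬ Chain f l' ψ a b) := fun l' hl' => ih _ (by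
            rw [← hn]; exact Nat.lt_succ_of_le hl') l' rfl
      have hsplit : Split (fun f a q b => (∀ u, a < u → u < q → p.1.sat f u) ∧
        (MTLC.neg p.1).onset.sat f q ∧ (¬ p.2.sat f q ∨ ¬ Chain f l ψ q b) ∧
        ∀ s ∈ cuts l ψ, (¬ ∃ z, a < z ∧ z < q ∧ p.2.sat f z ∧ Chain f s.1.1 s.1.2 z q) ∨
          ¬ s.2.1.sat f q ∨ ¬ Chain f s.2.2 ψ q b) :=
        (Split.left (all _)).and ((Split.left (right _)).and
          (((Split.left (right (.neg p.2))).or (Split.right (ih' l le_rfl))).and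
          (Split.forall_mem _ fun s hs => (Split.left (not_exists_chain _ _ _)).or
            ((Split.left (right (.neg s.2.1))).or
              (Split.right (ih' _ (length_of_mem_cuts hs)))))))
      exact ((left _).or (((all p.1).and (not_exists_chain _ _ _)).or
        hsplit.exists_dec)).congr fun _ _ _ _ => not_chain_cons_iff.symm

/-- Decomposable relations are closed under complement. -/
lemma not {R : BRel} (hR : Dec R) : Dec (fun f a b => ¬ R f a b) := by
  induction hR with
  | chain α l ψ β =>
    refine ((left (.neg α)).or ((not_chain l ψ).or (right (.neg β)))).congr fun f a b _ => ?_
    simp only [MTLC.sat_neg]; tauto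
  | or _ _ ih1 ih2 => exact (ih1.and ih2).congr fun f a b _ => by tauto
  | congr _ h ih => exact ih.congr fun f a b hab => by rw [h f a b hab]

end Dec

lemma Split.not {T : Sig → ℝ → ℝ → ℝ → Prop} (h : Split T) :
    Split (fun f a p b => ¬ T f a p b) := by
  refine ProdClass.not ?_ ?_ ?_ ?_ ?_ ?_ h
  · rintro _ _ ⟨R, hR, rfl⟩ ⟨S, hS, rfl⟩
    exact ⟨_, hR.and hS, rfl⟩
  · rintro _ _ ⟨R, hR, rfl⟩ ⟨S, hS, rfl⟩
    exact ⟨_, hR.and hS, rfl⟩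
  · rintro _ ⟨R, hR, rfl⟩
    exact ⟨_, hR.not, rfl⟩
  · rintro _ ⟨R, hR, rfl⟩
    exact ⟨_, hR.not, rfl⟩
  · exact ⟨_, .const True, rfl⟩
  · exact ⟨_, .const True, rfl⟩

/-! ### Projections -/

/-- The formula holding at `a` when a chain leads from `a` to some point `b > a` satisfying
`β`. -/
def untilChain : List (Fm × Fm) → Fm → Fm → Fm
  | [], ψ, β => .untilF ψ β
  | p :: l, ψ, β => .untilF p.1 (.conj p.2 (untilChain l ψ β))

/-- The conditions satisfied by the points of a chain leading to `β`. -/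
def untilStages : List (Fm × Fm) → Fm → Fm → List Fm
  | [], _, β => [β]
  | p :: l, ψ, β => .conj p.2 (untilChain l ψ β) :: untilStages l ψ β

lemma sat_untilChain {f : Sig} {l : List (Fm × Fm)} {ψ β : Fm} {a : ℝ} :
    (untilChain l ψ β).sat f a ↔ ∃ b, a < b ∧ Chain f l ψ a b ∧ β.sat f b := by
  induction l generalizing a with
  | nil =>
    simp only [untilChain, Chain, MTLC.sat_untilF]
    exact exists_congr fun b => by tauto
  | cons p l ih =>
    simp only [untilChain, ih, Chain, MTLC.sat_conj, MTLC.sat_untilF]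
    constructor
    · rintro ⟨z, h1, ⟨h2, b, h3, h4, h5⟩, h6⟩
      exact ⟨b, h1.trans h3, ⟨z, h1, h3, h6, h2, h4⟩, h5⟩
    · rintro ⟨b, h, ⟨z, h1, h3, h6, h2, h4⟩, h5⟩
      exact ⟨z, h1, ⟨h2, b, h3, h4, h5⟩, h6⟩

lemma exists_chain_to_iff {f : Sig} {l : List (Fm × Fm)} {ψ β : Fm} {a b : ℝ} :
    (∃ y, a < y ∧ y < b ∧ Chain f l ψ a y ∧ β.sat f y) ↔
      (untilChain l ψ β).sat f a ∧ Inc f (untilStages l ψ β) a b := by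
  induction l generalizing a with
  | nil =>
    simp only [untilChain, untilStages, Inc, Chain, MTLC.sat_untilF, and_true]
    constructor
    · rintro ⟨z, h1, h2, h3, h4⟩
      exact ⟨⟨z, h1, h4, h3⟩, z, h1, h2, h4⟩
    · rintro ⟨⟨w, h1, h2, h3⟩, z, h4, h5, h6⟩
      rcases le_or_gt z w with h | h
      · exact ⟨z, h4, h5, fun u hu hu' => h3 u hu (hu'.trans_le h), h6⟩
      · exact ⟨w, h1, h.trans h5, h3, h2⟩
  | cons p l ih =>
    simp only [untilChain, untilStages, Inc, Chain, MTLC.sat_conj, MTLC.sat_untilF]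
    constructor
    · rintro ⟨y, h1, h2, ⟨z, h3, h4, h5, h6, h7⟩, h8⟩
      obtain ⟨h9, h10⟩ := (ih (a := z)).1 ⟨y, h4, h2, h7, h8⟩
      exact ⟨⟨z, h3, ⟨h6, h9⟩, h5⟩, z, h3, h4.trans h2, ⟨h6, h9⟩, h10⟩
    · rintro ⟨⟨w, h1, ⟨h2, h3⟩, h4⟩, z, h5, h6, ⟨h7, h8⟩, h9⟩
      rcases le_or_gt z w with h | h
      · obtain ⟨y, h10, h11, h12, h13⟩ := ih.2 ⟨h8, h9⟩
        exact ⟨y, h5.trans h10, h11, ⟨z, h5, h10, fun u hu hu' => h4 u hu (hu'.trans_le h), h7,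
          h12⟩, h13⟩
      · obtain ⟨y, h10, h11, h12, h13⟩ := ih.2 ⟨h3, h9.mono h.le le_rfl⟩
        exact ⟨y, h1.trans h10, h11, ⟨w, h1, h10, h4, h2, h12⟩, h13⟩

lemma Dec.exists_right {R : BRel} (hR : Dec R) :
    Definable (fun f a => ∃ b, a < b ∧ R f a b) := by
  induction hR with
  | chain α l ψ β =>
    refine ⟨.conj α (untilChain l ψ β), fun f a => ?_⟩
    rw [MTLC.sat_conj, sat_untilChain, ← exists_and_left]
    exact exists_congr fun b => by tauto
  | or _ _ ih1 ih2 =>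
    refine (ih1.or ih2).congr fun f a => ?_
    simp only [← exists_or, ← and_or_left]
  | congr _ h ih =>
    exact ih.congr fun f a => exists_congr fun b => and_congr_right fun hab => h f a b hab

lemma Dec.exists_left {R : BRel} (hR : Dec R) :
    Definable (fun f b => ∃ a, a < b ∧ R f a b) := by
  induction hR with
  | chain α l ψ β =>
    refine ⟨.conj (sinceChain α l ψ) β, fun f a => ?_⟩
    rw [MTLC.sat_conj, sat_sinceChain, ← exists_and_right]
    exact exists_congr fun b => by tauto
  | or _ _ ih1 ih2 =>
    refine (ih1.or ih2).congr fun f a => ?_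
    simp only [← exists_or, ← and_or_left]
  | congr _ h ih =>
    exact ih.congr fun f b => exists_congr fun a => and_congr_right fun hab => h f a b hab

lemma Dec.of_right {X : Sig → ℝ → Prop} (hX : Definable X) : Dec (fun f _ b => X f b) := by
  obtain ⟨φ, hφ⟩ := hX
  exact (Dec.right φ).congr fun f _ b _ => hφ f b

lemma Split.exists_right {T : Sig → ℝ → ℝ → ℝ → Prop} (hT : Split T) :
    Dec (fun f a p => ∃ b, p < b ∧ T f a p b) := by
  refine hT.induction (M := fun T => Dec (fun f a p => ∃ b, p < b ∧ T f a p b))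
    (fun hR hS => ?_) (fun h1 h2 => (h1.or h2).congr fun f a b _ => ?_)
    (fun h1 h2 => h1.congr fun f a p hp => exists_congr fun b => ?_)
  · refine (hR.and (Dec.of_right hS.exists_right)).congr fun f a p _ => ?_
    rw [← exists_and_left]
    exact exists_congr fun b => by tauto
  · simp only [← exists_or, ← and_or_left]
  · exact and_congr_right fun h4 => h2 f a p b hp h4

/-! ### Counting -/

section Inc
variable {f : Sig} {F : Fm} {l : List Fm} {a b x : ℝ}

lemma Inc.append_singleton {c : ℝ} (h : Inc f l a b) (hab : a < b) (hF : F.sat f b)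
    (hbc : b < c) : Inc f (l ++ [F]) a c := by
  induction l generalizing a with
  | nil => exact ⟨b, hab, hbc, hF, trivial⟩
  | cons G l ih =>
    obtain ⟨z, h1, h2, h3, h4⟩ := h
    exact ⟨z, h1, h2.trans hbc, h3, ih h4 h2⟩

lemma inc_replicate_iff {n : ℕ} : Inc f (List.replicate n F) a b ↔
    ∃ s : Fin n → ℝ, StrictMono s ∧ ∀ i, s i ∈ Set.Ioo a b ∧ F.sat f (s i) := by
  induction n generalizing a with
  | zero => simp [Inc, Subsingleton.strictMono]
  | succ n ih =>
    simp only [List.replicate_succ, Inc, ih]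
    constructor
    · rintro ⟨z, h1, h2, h3, s, hs, h4⟩
      refine ⟨Fin.cons z s, fun i j hij => ?_, fun i => ?_⟩
      · induction j using Fin.cases with
        | zero => exact absurd hij (Fin.not_lt_zero i)
        | succ j =>
          induction i using Fin.cases with
          | zero => simpa using (h4 j).1.1
          | succ i => simpa using hs (Fin.succ_lt_succ_iff.1 hij)
      · induction i using Fin.cases with
        | zero => exact ⟨⟨h1, h2⟩, h3⟩
        | succ i => exact ⟨⟨h1.trans (h4 i).1.1, (h4 i).1.2⟩, (h4 i).2⟩
    · rintro ⟨s, hs, h⟩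
      exact ⟨s 0, (h 0).1.1, (h 0).1.2, (h 0).2, fun i => s i.succ,
        fun i j hij => hs (Fin.succ_lt_succ_iff.2 hij),
        fun i => ⟨⟨hs (Fin.succ_pos i), (h _).1.2⟩, (h _).2⟩⟩

/-- `t` is the infimum of the times by which an increasing sequence of events after `x` can
be completed. -/
def IsEnd (f : Sig) (l : List Fm) (x t : ℝ) : Prop :=
  ¬ Inc f l x t ∧ ∀ t', t < t' → Inc f l x t'

lemma IsEnd.unique {t t' : ℝ} (h : IsEnd f l x t) (h' : IsEnd f l x t') : t = t' := by
  rcases lt_trichotomy t t' with hlt | h | hlt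
  · exact absurd (h.2 _ hlt) h'.1
  · exact h
  · exact absurd (h'.2 _ hlt) h.1

lemma IsEnd.exists_drop {x' t : ℝ} (h : IsEnd f l x' t) (hx : x' ≤ x) (hxt : x < t) :
    ∃ i < l.length, IsEnd f (l.drop i) x t := by
  induction l generalizing x' with
  | nil => exact absurd trivial h.1
  | cons F l ih =>
    by_cases hall : ∀ t', t < t' → Inc f (F :: l) x t'
    · exact ⟨0, by simp, fun h' => h.1 (h'.mono hx le_rfl), hall⟩
    · push Not at hall
      obtain ⟨t₁, ht₁, hn⟩ := hall
      have key : ∃ x'' ≤ x, ∀ b, x < b → (Inc f (F :: l) x' b ↔ Inc f l x'' b) := by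
        obtain ⟨z, h1, h2, h3, h4⟩ := h.2 t₁ ht₁
        have hzx : z ≤ x := not_lt.1 fun h5 => hn ⟨z, h5, h2, h3, h4⟩
        rcases exists_onset ⟨z, h1, h2, h3⟩ with h5 | ⟨r, h5, h6, h7, h8⟩
        · exact ⟨x', hx, fun b hb => inc_cons_of_accR h5 (hx.trans_lt hb)⟩
        · have hrz : r ≤ z := not_lt.1 fun h9 => h7 z h1 h9 h3
          exact ⟨r, hrz.trans hzx, fun b hb =>
            inc_cons_of_onset h5 ((hrz.trans hzx).trans_lt hb) h7 h8⟩
      obtain ⟨x'', hx'', hkey⟩ := key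
      obtain ⟨i, hi, h'⟩ := ih (x' := x'') ⟨fun h' => h.1 ((hkey t hxt).2 h'),
        fun t' ht' => (hkey t' (hxt.trans ht')).1 (h.2 t' ht')⟩ hx''
      exact ⟨i + 1, by simpa using hi, by simpa using h'⟩

/-- Some increasing sequence of events has its end at `t`. -/
def EndPoint (l : List Fm) (f : Sig) (t : ℝ) : Prop := ∃ x, x < t ∧ IsEnd f l x t

lemma not_inc_replicate_endPoint {τ : Fm} (hτ : ∀ r, τ.sat f r ↔ EndPoint l f r)
    (h : ¬ Inc f l x b) : ¬ Inc f (List.replicate (l.length + 1) τ) x b := by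
  rw [inc_replicate_iff]
  rintro ⟨s, hs, h'⟩
  have key : ∀ i, ∃ j : Fin l.length, IsEnd f (l.drop j) x (s i) := by
    intro i
    obtain ⟨⟨h1, h2⟩, h3⟩ := h' i
    obtain ⟨x', h4, h5⟩ := (hτ _).1 h3
    obtain ⟨j, hj, h6⟩ := h5.exists_drop (x := x) (le_of_not_gt fun hx =>
      h ((h5.2 b h2).mono hx.le le_rfl)) h1
    exact ⟨⟨j, hj⟩, h6⟩
  choose g hg using key
  obtain ⟨i, j, hij, hgij⟩ := Fintype.exists_ne_map_eq_of_card_lt g (by simp)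
  exact hij (hs.injective ((hg i).unique (hgij ▸ hg j)))

end Inc

lemma definable_endPoint (l : List Fm) : Definable (EndPoint l) := by
  have h1 : Dec (fun f x t => ∀ t', t < t' → Inc f l x t') :=
    ((Split.of_dec (Dec.not_inc l)).exists_right.not).congr fun f x t _ => by
      push Not; exact Iff.rfl
  exact ((Dec.not_inc l).and h1).exists_left

/-- Whether increasing sequences of events occur within one time unit is definable. -/
lemma definable_inc_one (l : List Fm) : Definable (fun f x => Inc f l x (x + 1)) := by
  by_cases hl : l = []
  · subst hl
    exact (Definable.const True).congr fun f x => by simp [Inc]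
  obtain ⟨τ, hτ⟩ := definable_endPoint l
  have hV : Definable (fun f x => ∀ t, x < t → Inc f l x t) :=
    ((Dec.not_inc l).exists_right.not).congr fun f x => by push Not; exact Iff.rfl
  have hC : ∀ k, Definable (fun f x => Inc f (List.replicate k τ) x (x + 1)) := fun k =>
    (Definable.sat (.fcount k τ)).congr fun f x => inc_replicate_iff.symm
  refine (hV.or (Definable.exists_mem (List.range (l.length + 2)) (Z := fun k f x =>
    Inc f (List.replicate k τ) x (x + 1) ∧
      ¬ ∃ y, x < y ∧ ¬ Inc f l x y ∧ Inc f (List.replicate k τ) x y) fun k _ =>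
    (hC k).and ((Dec.not_inc l).and (Dec.inc _)).exists_right.not)).congr fun f x => ?_
  constructor
  · rintro (h | ⟨k, -, h1, h2⟩)
    · exact h _ (by linarith)
    · by_contra h
      exact h2 ⟨x + 1, by linarith, h, h1⟩
  · intro h
    rw [or_iff_not_imp_left]
    intro hV
    push Not at hV
    obtain ⟨t₀, ht₀, hn⟩ := hV
    set s := {t | x < t ∧ Inc f l x t}
    have hbdd : BddBelow s := ⟨x, fun t ht => ht.1.le⟩
    have hne : s.Nonempty := ⟨x + 1, by linarith, h⟩
    set e := sInf s
    have hxe : x < e := ht₀.trans_le (le_csInf hne fun t ht => by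
      by_contra! hlt
      exact hn (ht.2.mono le_rfl hlt.le))
    have hopen : ∀ y, x < y → Inc f l x y → e < y := fun y hy hI => by
      obtain ⟨a', b', h1, h2, h3, h4⟩ := hI.exists_gt hl
      exact (csInf_le hbdd ⟨h1.trans h2, h4.mono h1.le le_rfl⟩).trans_lt h3
    have hend : IsEnd f l x e := by
      refine ⟨fun hI => lt_irrefl _ (hopen e hxe hI), fun t' ht' => ?_⟩
      obtain ⟨t, ht, htt⟩ := exists_lt_of_csInf_lt hne ht'
      exact ht.2.mono le_rfl htt.le
    have hex : ∃ k, ¬ Inc f (List.replicate k τ) x e :=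
      ⟨_, not_inc_replicate_endPoint (hτ f) hend.1⟩
    classical
    have hk := Nat.find_spec hex
    have hkle := Nat.find_min' hex (not_inc_replicate_endPoint (hτ f) hend.1)
    have hmin := fun m => Nat.find_min hex (m := m)
    generalize Nat.find hex = k at hk hkle hmin
    refine ⟨k, List.mem_range.2 (by omega), ?_, ?_⟩
    · cases k with
      | zero => exact absurd trivial hk
      | succ k =>
        rw [List.replicate_succ']
        exact (not_not.1 (hmin k (Nat.lt_succ_self k))).append_singleton hxe
          ((hτ f e).2 ⟨x, hxe, hend⟩) (hopen _ (by linarith) h)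
    · rintro ⟨y, hy, h1, h2⟩
      exact hk (h2.mono le_rfl (le_of_not_gt fun hlt => h1 (hend.2 y hlt)))

/-- Bounded projection. -/
lemma Dec.exists_right_one {R : BRel} (hR : Dec R) :
    Definable (fun f a => ∃ b, a < b ∧ b < a + 1 ∧ R f a b) := by
  induction hR with
  | chain α l ψ β =>
    refine ((Definable.sat α).and ((Definable.sat (untilChain l ψ β)).and
      (definable_inc_one (untilStages l ψ β)))).congr fun f a => ?_
    rw [← exists_chain_to_iff, ← exists_and_left]
    exact exists_congr fun b => by tauto
  | or _ _ ih1 ih2 =>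
    refine (ih1.or ih2).congr fun f a => ?_
    simp only [← exists_or, ← and_or_left]
  | congr _ h ih =>
    exact ih.congr fun f a => exists_congr fun b => and_congr_right fun hab =>
      and_congr_right fun _ => h f a b hab

/-! ### Evaluating a decomposable relation at a fixed distance -/

/-- Partial functions `x ↦ a` with `x ≤ a` which preserve decomposability. -/
structure Start (A : BRel) : Prop where
  le : ∀ {f x a}, A f x a → x ≤ a
  unique : ∀ {f x a a'}, A f x a → A f x a' → a = a'
  dec : ∀ {R : BRel}, Dec R → Dec (fun f x y => ∃ a, a < y ∧ A f x a ∧ R f a y)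

lemma Start.eq : Start (fun _ x a => x = a) where
  le h := h.le
  unique h h' := h.symm.trans h'
  dec hR := hR.congr fun f x y hxy =>
    ⟨fun h => ⟨x, hxy, rfl, h⟩, by rintro ⟨a, -, rfl, h⟩; exact h⟩

/-- The first point from `a` on at which `ψ` ceases to hold, provided it satisfies `Q`. -/
lemma Start.next {A Q : BRel} (hA : Start A) (ψ : Fm) (hQ : Dec Q) :
    Start (fun f x p => ∃ a, a < p ∧ A f x a ∧ (∀ u, a < u → u < p → ψ.sat f u) ∧
      (MTLC.neg ψ).onset.sat f p ∧ Q f a p) where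
  le := by
    rintro f x p ⟨a, h1, h2, -⟩
    exact (hA.le h2).trans h1.le
  unique := by
    have key : ∀ {f : Sig} {a p p' : ℝ}, a < p → (MTLC.neg ψ).onset.sat f p →
        (∀ u, a < u → u < p' → ψ.sat f u) → p' ≤ p := by
      intro f a p p' h1 h2 h3
      by_contra! hlt
      rw [MTLC.sat_onset] at h2
      rcases h2 with h2 | h2
      · exact h2 (h3 p h1 hlt)
      · obtain ⟨u, hu, hu', h4⟩ := h2 p' hlt
        exact h4 (h3 u (h1.trans hu) hu')
    rintro f x p p' ⟨a, h1, h2, h3, h4, -⟩ ⟨a', h1', h2', h3', h4', -⟩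
    obtain rfl := hA.unique h2 h2'
    exact le_antisymm (key h1' h4' h3) (key h1 h4 h3')
  dec {R} hR := by
    refine (hA.dec ((((Dec.all ψ).and ((Dec.right (MTLC.neg ψ).onset).and hQ))).cat hR)).congr
      fun f x y _ => ?_
    constructor
    · rintro ⟨a, h1, h2, p, h3, h4, h5, h6⟩
      exact ⟨p, h4, ⟨a, h3, h2, h5⟩, h6⟩
    · rintro ⟨p, h4, ⟨a, h3, h2, h5⟩, h6⟩
      exact ⟨a, h3.trans h4, h2, p, h3, h4, h5, h6⟩

lemma stages_ne_nil (B : Fm) (l : List (Fm × Fm)) : stages B l ≠ [] := by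
  cases l <;> simp [stages]

lemma Start.definable_all {A : BRel} (hA : Start A) (ψ : Fm) : Definable (fun f x =>
    ∃ a, a < x + 1 ∧ A f x a ∧ ∀ u, a < u → u < x + 1 → ψ.sat f u) := by
  refine ((hA.dec (.const True)).exists_right_one.and
    (hA.dec (.right (.neg ψ))).exists_right_one.not).congr fun f x => ?_
  constructor
  · rintro ⟨⟨y, h1, h2, a, h3, h4, -⟩, h5⟩
    refine ⟨a, h3.trans h2, h4, fun u hu hu' => ?_⟩
    by_contra hψ
    exact h5 ⟨u, (hA.le h4).trans_lt hu, hu', a, hu, h4, hψ⟩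
  · rintro ⟨a, h1, h2, h3⟩
    constructor
    · obtain ⟨y, h4, h5⟩ := exists_between h1
      exact ⟨y, (hA.le h2).trans_lt h4, h5, a, h4, h2, trivial⟩
    · rintro ⟨y, h4, h5, a', h6, h7, h8⟩
      obtain rfl := hA.unique h2 h7
      exact h8 (h3 y h6 h5)

lemma Start.definable_chain (l : List (Fm × Fm)) (ψ : Fm) {A : BRel} (hA : Start A) :
    Definable (fun f x => ∃ a, a < x + 1 ∧ A f x a ∧ Chain f l ψ a (x + 1)) := by
  induction hn : l.length using Nat.strong_induction_on generalizing l A with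
  | _ n ih =>
    cases l with
    | nil => exact hA.definable_all ψ
    | cons p l =>
      have ih' : ∀ {A : BRel}, Start A → ∀ l' : List (Fm × Fm), l'.length ≤ l.length →
          Definable (fun f x => ∃ a, a < x + 1 ∧ A f x a ∧ Chain f l' ψ a (x + 1)) :=
        fun hA l' hl' => ih _ (by rw [← hn]; exact Nat.lt_succ_of_le hl') l' hA rfl
      have d1 := (hA.definable_all p.1).and
        (((Definable.sat (sinceChain p.2 l ψ)).shift 1).and
          (hA.dec (Dec.inc (stages p.2 l))).exists_right_one)
      have d2 := ih' (hA.next p.1 (Dec.right p.2)) l le_rfl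
      have d3 := Definable.exists_mem (cuts l ψ) fun s hs =>
        ih' (hA.next p.1 ((Dec.exists_chain p.2 s.1.1 s.1.2).and_right s.2.1)) s.2.2
          (length_of_mem_cuts hs)
      refine (d1.or (d2.or d3)).congr fun f x => ?_
      constructor
      · rintro (⟨⟨a, h1, h2, h3⟩, h4, y, h5, h6, a', h7, h8, h9⟩ |
          ⟨q, h1, ⟨a, h2, h3, h4, h5, h6⟩, h7⟩ |
          ⟨s, hs, q, h1, ⟨a, h2, h3, h4, h5, h6, h8⟩, h7⟩)
        · obtain rfl := hA.unique h2 h8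
          obtain ⟨z, h10, h11, h12⟩ := exists_chain_iff.2
            ⟨by simpa using h4, h9.mono le_rfl h6.le⟩
          exact ⟨a, h1, h2, z, h10, h11, fun u hu hu' => h3 u hu (hu'.trans h11), h12⟩
        · exact ⟨a, h2.trans h1, h3,
            (chain_cons_iff_of_onset h2 h1 h4 h5).2 (Or.inl ⟨h6, h7⟩)⟩
        · exact ⟨a, h2.trans h1, h3,
            (chain_cons_iff_of_onset h2 h1 h4 h5).2 (Or.inr ⟨s, hs, h6, h8, h7⟩)⟩
      · rintro ⟨a, h1, h2, h3⟩
        by_cases hall : ∀ u, a < u → u < x + 1 → p.1.sat f u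
        · left
          obtain ⟨z, h4, h5, -, h6⟩ := h3
          obtain ⟨h7, h8⟩ := exists_chain_iff.1 ⟨z, h4, h5, h6⟩
          obtain ⟨a', b', h9, h10, h11, h12⟩ := h8.exists_gt (stages_ne_nil _ _)
          exact ⟨⟨a, h1, h2, hall⟩, by simpa using h7, b',
            (hA.le h2).trans_lt (h9.trans h10), h11, a, h9.trans h10, h2,
            h12.mono h9.le le_rfl⟩
        · right
          push Not at hall
          rcases exists_onset (F := .neg p.1) (f := f) hall with h4 | ⟨q, h4, h5, h6, h7⟩
          · exfalso
            obtain ⟨z, h5, -, h6, -⟩ := h3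
            rw [MTLC.sat_accR] at h4
            obtain ⟨u, h7, h8, h9⟩ := h4 z h5
            exact h9 (h6 u h7 h8)
          · have h6' : ∀ u, a < u → u < q → p.1.sat f u := fun u hu hu' => by
              simpa using h6 u hu hu'
            rcases (chain_cons_iff_of_onset h4 h5 h6' h7).1 h3 with ⟨h8, h9⟩ |
              ⟨s, hs, h8, h9, h10⟩
            · exact Or.inl ⟨q, h5, ⟨a, h4, h2, h6', h7, h8⟩, h9⟩
            · exact Or.inr ⟨s, hs, q, h5, ⟨a, h4, h2, h6', h7, h8, h9⟩, h10⟩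

namespace Dec
variable {R : BRel}

lemma definable_one (hR : Dec R) : Definable (fun f x => R f x (x + 1)) := by
  induction hR with
  | chain α l ψ β =>
    refine ((Definable.sat α).and ((Start.eq.definable_chain l ψ).and
      ((Definable.sat β).shift 1))).congr fun f x => ?_
    simp
  | or _ _ ih1 ih2 => exact ih1.or ih2
  | congr _ h ih => exact ih.congr fun f x => h f _ _ (by linarith)

lemma definable_nat (hR : Dec R) (n : ℕ) : Definable (fun f x => R f x (x + (n + 1))) := by
  induction n generalizing R with
  | zero => simpa using hR.definable_one
  | succ n ih =>
    have key : ∀ {T : Sig → ℝ → ℝ → ℝ → Prop}, Split T →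
        Definable (fun f x => T f x (x + 1) (x + 1 + (n + 1))) := fun hT =>
      hT.induction (M := fun T => Definable (fun f x => T f x (x + 1) (x + 1 + (n + 1))))
        (fun hR hS => (hR.definable_one.and ((ih hS).shift 1)).congr fun f x => by simp)
        (fun h1 h2 => h1.or h2)
        (fun h1 h2 => h1.congr fun f x => h2 f _ _ _ (by linarith) (by linarith))
    refine (key (Split.of_dec hR)).congr fun f x => ?_
    push_cast
    rw [show x + 1 + ((n : ℝ) + 1) = x + (n + 1 + 1) by ring]

/-- The diagonal property `R(x + c, x + d)` is definable. -/
lemma definable_int (hR : Dec R) (c d : ℤ) :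
    Definable (fun f x => x + c < x + d ∧ R f (x + c) (x + d)) := by
  rcases lt_or_ge c d with h | h
  · obtain ⟨n, hn⟩ := Int.eq_ofNat_of_zero_le (show 0 ≤ d - c - 1 by omega)
    have hd : (d : ℝ) = c + (n + 1) := by
      have : d = c + (n + 1) := by omega
      rw [this]; push_cast; ring
    refine ((hR.definable_nat n).shift c).congr fun f x => ?_
    have hpos : x + (c : ℝ) < x + d := by
      have : (c : ℝ) < d := by exact_mod_cast h
      linarith
    rw [hd] at hpos ⊢
    simp only [hpos, true_and]
    rw [add_assoc]
  · refine (Definable.const False).congr fun f x => ?_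
    have : (d : ℝ) ≤ c := by exact_mod_cast h
    constructor
    · exact False.elim
    · rintro ⟨h1, -⟩
      linarith

end Dec

/-! ### Quantifier elimination -/

/-- The value of the term `x_i + c`. -/
def tval (v : ℕ → ℝ) (t : ℕ × ℤ) : ℝ := v t.1 + t.2

/-- Properties of valuations which are Boolean combinations of definable properties of terms
and of decomposable relations between terms. -/
inductive Reduced : (Sig → (ℕ → ℝ) → Prop) → Prop
  | un (φ : Fm) (t : ℕ × ℤ) : Reduced (fun f v => φ.sat f (tval v t))
  | bin {R : BRel} (hR : Dec R) (s t : ℕ × ℤ) :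
      Reduced (fun f v => tval v s < tval v t ∧ R f (tval v s) (tval v t))
  | and {Φ Ψ : Sig → (ℕ → ℝ) → Prop} : Reduced Φ → Reduced Ψ →
      Reduced (fun f v => Φ f v ∧ Ψ f v)
  | not {Φ : Sig → (ℕ → ℝ) → Prop} : Reduced Φ → Reduced (fun f v => ¬ Φ f v)

namespace Reduced
variable {Φ Ψ : Sig → (ℕ → ℝ) → Prop}

lemma congr (h : Reduced Φ) (h' : ∀ f v, Φ f v ↔ Ψ f v) : Reduced Ψ :=
  (funext fun f => funext fun v => propext (h' f v) : Φ = Ψ) ▸ h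

lemma or (h : Reduced Φ) (h' : Reduced Ψ) : Reduced (fun f v => Φ f v ∨ Ψ f v) :=
  (h.not.and h'.not).not.congr fun f v => by tauto

lemma const (p : Prop) : Reduced (fun _ _ => p) := by
  by_cases hp : p
  · exact (un .tt (0, 0)).congr fun f v => by simp [hp]
  · exact (un (.neg .tt) (0, 0)).congr fun f v => by simp [hp]

lemma of_definable {X : Sig → ℝ → Prop} (hX : Definable X) (t : ℕ × ℤ) :
    Reduced (fun f v => X f (tval v t)) := by
  obtain ⟨φ, hφ⟩ := hX
  exact (un φ t).congr fun f v => hφ f _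

lemma lt (s t : ℕ × ℤ) : Reduced (fun _ v => tval v s < tval v t) :=
  (bin (.const True) s t).congr fun f v => by simp

lemma le (s t : ℕ × ℤ) : Reduced (fun _ v => tval v s ≤ tval v t) :=
  (lt t s).not.congr fun _ _ => not_lt

lemma eq (s t : ℕ × ℤ) : Reduced (fun _ v => tval v s = tval v t) :=
  ((le s t).and (le t s)).congr fun _ _ => le_antisymm_iff.symm

lemma exists_mem {ι : Type*} (s : Finset ι) {Z : ι → Sig → (ℕ → ℝ) → Prop}
    (h : ∀ i ∈ s, Reduced (Z i)) : Reduced (fun f v => ∃ i ∈ s, Z i f v) := by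
  classical
  induction s using Finset.induction_on with
  | empty => exact (const False).congr fun f v => by simp
  | insert i s _ ih =>
    exact ((h i (by simp)).or (ih fun j hj => h j (by simp [hj]))).congr fun f v => by simp

lemma forall_mem {ι : Type*} (s : Finset ι) {Z : ι → Sig → (ℕ → ℝ) → Prop}
    (h : ∀ i ∈ s, Reduced (Z i)) : Reduced (fun f v => ∀ i ∈ s, Z i f v) :=
  (exists_mem s fun i hi => (h i hi).not).not.congr fun f v => by push Not; exact Iff.rfl

/-- Substitution of a term for a variable. -/
lemma subst (h : Reduced Φ) (y : ℕ) (t : ℕ × ℤ) :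
    Reduced (fun f v => Φ f (Function.update v y (tval v t))) := by
  have key : ∀ s : ℕ × ℤ, ∃ s', ∀ v, tval (Function.update v y (tval v t)) s = tval v s' := by
    intro s
    by_cases hs : s.1 = y
    · refine ⟨(t.1, t.2 + s.2), fun v => ?_⟩
      simp [tval, hs, add_assoc]
    · exact ⟨s, fun v => by simp [tval, hs]⟩
  induction h with
  | un φ s =>
    obtain ⟨s', h⟩ := key s
    simpa only [h] using un φ s'
  | bin hR s s₁ =>
    obtain ⟨s', h⟩ := key s
    obtain ⟨s₁', h₁⟩ := key s₁
    simpa only [h, h₁] using bin hR s' s₁'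
  | and _ _ ih1 ih2 => exact ih1.and ih2
  | not _ ih => exact ih.not

/-- On constant valuations, reduced properties are definable. -/
lemma definable (h : Reduced Φ) : Definable (fun f r => Φ f fun _ => r) := by
  induction h with
  | un φ t => exact (Definable.sat φ).shift t.2
  | bin hR s t => exact hR.definable_int s.2 t.2
  | and _ _ ih1 ih2 => exact ih1.and ih2
  | not _ ih => exact ih.not

end Reduced

/-- A signal with a valuation and a further point. -/
structure Config where
  /-- the signal -/
  sig : Sig
  /-- the valuation -/
  val : ℕ → ℝ
  /-- the point -/
  pt : ℝ

/-- Properties of configurations not depending on the point, given by reduced properties. -/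
def OuterClass (A : Config → Prop) : Prop := ∃ Φ, Reduced Φ ∧ A = fun x => Φ x.sig x.val

/-- A region `D` of configurations in which the relations between the point and the terms
in `𝒯` can be separated, using properties in `ℬ` of the point. -/
structure Region (𝒯 : Finset (ℕ × ℤ)) (ℬ : (Config → Prop) → Prop) (D : Config → Prop) :
    Prop where
  and : ∀ {A B}, ℬ A → ℬ B → ℬ fun x => A x ∧ B x
  not : ∀ {A}, ℬ A → ℬ fun x => ¬ A x
  un : ∀ φ : Fm, ℬ fun x => φ.sat x.sig x.pt
  left : ∀ {R}, Dec R → ∀ t ∈ 𝒯, ProdClass OuterClass ℬ D fun x =>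
    tval x.val t < x.pt ∧ R x.sig (tval x.val t) x.pt
  right : ∀ {R}, Dec R → ∀ t ∈ 𝒯, ProdClass OuterClass ℬ D fun x =>
    x.pt < tval x.val t ∧ R x.sig x.pt (tval x.val t)
  proj : ∀ {B}, ℬ B → Reduced fun f v => ∃ r, D ⟨f, v, r⟩ ∧ B ⟨f, v, r⟩

namespace Region
variable {𝒯 𝒯' : Finset (ℕ × ℤ)} {ℬ : (Config → Prop) → Prop} {D : Config → Prop}

lemma mono (h : Region 𝒯 ℬ D) (h' : 𝒯' ⊆ 𝒯) : Region 𝒯' ℬ D :=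
  { h with
    left := fun hR t ht => h.left hR t (h' ht)
    right := fun hR t ht => h.right hR t (h' ht) }

lemma top (h : Region 𝒯 ℬ D) : ℬ fun _ => True := by simpa using h.un .tt

lemma outer (h : Region 𝒯 ℬ D) {Φ : Sig → (ℕ → ℝ) → Prop} (hΦ : Reduced Φ) :
    ProdClass OuterClass ℬ D fun x => Φ x.sig x.val :=
  (ProdClass.base ⟨Φ, hΦ, rfl⟩ h.top).congr fun x _ => by simp

lemma inner (h : Region 𝒯 ℬ D) {X : Sig → ℝ → Prop} (hX : Definable X) :
    ProdClass OuterClass ℬ D fun x => X x.sig x.pt := by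
  obtain ⟨φ, hφ⟩ := hX
  exact (ProdClass.base ⟨_, .const True, rfl⟩ (h.un φ)).congr fun x _ => by simp [hφ]

lemma projection (h : Region 𝒯 ℬ D) {A : Config → Prop} (hA : ProdClass OuterClass ℬ D A) :
    Reduced fun f v => ∃ r, D ⟨f, v, r⟩ ∧ A ⟨f, v, r⟩ := by
  induction hA with
  | base hA hB =>
    obtain ⟨Φ, hΦ, rfl⟩ := hA
    refine (hΦ.and (h.proj hB)).congr fun f v => ?_
    rw [← exists_and_left]
    exact exists_congr fun r => by tauto
  | or _ _ ih1 ih2 =>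
    refine (ih1.or ih2).congr fun f v => ?_
    simp only [← exists_or, ← and_or_left]
  | congr _ h' ih =>
    exact ih.congr fun f v => exists_congr fun r => and_congr_right fun hD => h' _ hD

end Region

/-- Every reduced property mentions finitely many terms not containing a given variable, and
can be separated in the regions determined by these terms. -/
lemma Reduced.separate {Φ : Sig → (ℕ → ℝ) → Prop} (hΦ : Reduced Φ) (y : ℕ) :
    ∃ 𝒯 : Finset (ℕ × ℤ), ∀ ℬ D, Region 𝒯 ℬ D → ProdClass OuterClass ℬ D fun x =>
      Φ x.sig (Function.update x.val y x.pt) := by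
  have hy : ∀ {t : ℕ × ℤ}, t.1 = y → ∀ v r, tval (Function.update v y r) t = r + t.2 := by
    intro t ht v r
    simp [tval, ht]
  have hn : ∀ {t : ℕ × ℤ}, t.1 ≠ y → ∀ v r, tval (Function.update v y r) t = tval v t := by
    intro t ht v r
    simp [tval, ht]
  induction hΦ with
  | un φ t =>
    refine ⟨∅, fun ℬ D hD => ?_⟩
    by_cases ht : t.1 = y
    · simp only [hy ht]
      exact hD.inner ((Definable.sat φ).shift t.2)
    · simp only [hn ht]
      exact hD.outer (.un φ t)
  | bin hR s t =>
    by_cases hs : s.1 = y <;> by_cases ht : t.1 = y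
    · refine ⟨∅, fun ℬ D hD => ?_⟩
      simp only [hy hs, hy ht]
      exact hD.inner (hR.definable_int s.2 t.2)
    · refine ⟨{(t.1, t.2 - s.2)}, fun ℬ D hD => ?_⟩
      simp only [hy hs, hn ht]
      refine (hD.right (hR.shift s.2) _ (Finset.mem_singleton_self _)).congr fun x _ => ?_
      have : tval x.val (t.1, t.2 - s.2) = tval x.val t - s.2 := by simp [tval]; ring
      rw [this, lt_sub_iff_add_lt, sub_add_cancel]
    · refine ⟨{(s.1, s.2 - t.2)}, fun ℬ D hD => ?_⟩
      simp only [hn hs, hy ht]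
      refine (hD.left (hR.shift t.2) _ (Finset.mem_singleton_self _)).congr fun x _ => ?_
      have : tval x.val (s.1, s.2 - t.2) = tval x.val s - t.2 := by simp [tval]; ring
      rw [this, sub_lt_iff_lt_add, sub_add_cancel]
    · refine ⟨∅, fun ℬ D hD => ?_⟩
      simp only [hn hs, hn ht]
      exact hD.outer (.bin hR s t)
  | and _ _ ih1 ih2 =>
    obtain ⟨𝒯₁, h1⟩ := ih1
    obtain ⟨𝒯₂, h2⟩ := ih2
    refine ⟨𝒯₁ ∪ 𝒯₂, fun ℬ D hD => ?_⟩
    refine ProdClass.and ?_ hD.and (h1 _ _ (hD.mono Finset.subset_union_left))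
      (h2 _ _ (hD.mono Finset.subset_union_right))
    rintro _ _ ⟨Φ, hΦ, rfl⟩ ⟨Ψ, hΨ, rfl⟩
    exact ⟨_, hΦ.and hΨ, rfl⟩
  | not _ ih =>
    obtain ⟨𝒯, h⟩ := ih
    refine ⟨𝒯, fun ℬ D hD => ?_⟩
    refine ProdClass.not ?_ hD.and ?_ hD.not ⟨_, .const True, rfl⟩ hD.top (h _ _ hD)
    · rintro _ _ ⟨Φ, hΦ, rfl⟩ ⟨Ψ, hΨ, rfl⟩
      exact ⟨_, hΦ.and hΨ, rfl⟩
    · rintro _ ⟨Φ, hΦ, rfl⟩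
      exact ⟨_, hΦ.not, rfl⟩

/-! ### The regions determined by finitely many terms -/

section Regions
variable {ℬ : (Config → Prop) → Prop} {D : Config → Prop} {s t : ℕ × ℤ} {R : BRel}

lemma prodClass_left (hℬ : ∀ {R}, Dec R → ℬ fun x => R x.sig (tval x.val t) x.pt)
    (hD : ∀ x, D x → tval x.val t < x.pt ∧ (tval x.val s < x.pt → tval x.val s ≤ tval x.val t))
    (hR : Dec R) : ProdClass OuterClass ℬ D fun x =>
      tval x.val s < x.pt ∧ R x.sig (tval x.val s) x.pt := by
  have key : ∀ {T : Sig → ℝ → ℝ → ℝ → Prop}, Split T → ProdClass OuterClass ℬ D fun x =>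
      tval x.val s < tval x.val t ∧ T x.sig (tval x.val s) (tval x.val t) x.pt := by
    intro T hT
    refine hT.induction (M := fun T => ProdClass OuterClass ℬ D fun x =>
      tval x.val s < tval x.val t ∧ T x.sig (tval x.val s) (tval x.val t) x.pt)
      (fun hR hS => ?_) (fun h1 h2 => (h1.or h2).congr fun x _ => by tauto)
      (fun h1 h2 => h1.congr fun x hx => and_congr_right fun h3 => h2 _ _ _ _ h3 (hD x hx).1)
    exact (ProdClass.base ⟨_, .bin hR s t, rfl⟩ (hℬ hS)).congr fun x _ => by tauto
  refine ((key (Split.of_dec hR)).or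
    (ProdClass.base ⟨_, .eq s t, rfl⟩ (hℬ hR))).congr fun x hx => ?_
  obtain ⟨h1, h2⟩ := hD x hx
  constructor
  · rintro (⟨h3, h4⟩ | ⟨h3, h4⟩)
    · exact ⟨h3.trans h1, h4⟩
    · rw [h3]
      exact ⟨h1, h4⟩
  · rintro ⟨h3, h4⟩
    rcases (h2 h3).lt_or_eq with h5 | h5
    · exact Or.inl ⟨h5, h4⟩
    · exact Or.inr ⟨h5, h5 ▸ h4⟩

lemma prodClass_right (hℬ : ∀ {R}, Dec R → ℬ fun x => R x.sig x.pt (tval x.val t))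
    (hD : ∀ x, D x → x.pt < tval x.val t ∧ (x.pt < tval x.val s → tval x.val t ≤ tval x.val s))
    (hR : Dec R) : ProdClass OuterClass ℬ D fun x =>
      x.pt < tval x.val s ∧ R x.sig x.pt (tval x.val s) := by
  have key : ∀ {T : Sig → ℝ → ℝ → ℝ → Prop}, Split T → ProdClass OuterClass ℬ D fun x =>
      tval x.val t < tval x.val s ∧ T x.sig x.pt (tval x.val t) (tval x.val s) := by
    intro T hT
    refine hT.induction (M := fun T => ProdClass OuterClass ℬ D fun x =>
      tval x.val t < tval x.val s ∧ T x.sig x.pt (tval x.val t) (tval x.val s))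
      (fun hR hS => ?_) (fun h1 h2 => (h1.or h2).congr fun x _ => by tauto)
      (fun h1 h2 => h1.congr fun x hx => and_congr_right fun h3 => h2 _ _ _ _ (hD x hx).1 h3)
    exact (ProdClass.base ⟨_, .bin hS t s, rfl⟩ (hℬ hR)).congr fun x _ => by tauto
  refine ((key (Split.of_dec hR)).or
    (ProdClass.base ⟨_, .eq s t, rfl⟩ (hℬ hR))).congr fun x hx => ?_
  obtain ⟨h1, h2⟩ := hD x hx
  constructor
  · rintro (⟨h3, h4⟩ | ⟨h3, h4⟩)
    · exact ⟨h1.trans h3, h4⟩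
    · rw [h3]
      exact ⟨h1, h4⟩
  · rintro ⟨h3, h4⟩
    rcases (h2 h3).lt_or_eq with h5 | h5
    · exact Or.inl ⟨h5, h4⟩
    · exact Or.inr ⟨h5.symm, h5 ▸ h4⟩

lemma region_between (𝒯 : Finset (ℕ × ℤ)) (t t' : ℕ × ℤ) : Region 𝒯
    (fun B => ∃ T, Split T ∧ B = fun x => T x.sig (tval x.val t) x.pt (tval x.val t'))
    (fun x => tval x.val t < x.pt ∧ x.pt < tval x.val t' ∧
      ∀ s ∈ 𝒯, ¬ (tval x.val t < tval x.val s ∧ tval x.val s < tval x.val t')) where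
  and := by
    rintro _ _ ⟨T, hT, rfl⟩ ⟨T', hT', rfl⟩
    exact ⟨_, hT.and hT', rfl⟩
  not := by
    rintro _ ⟨T, hT, rfl⟩
    exact ⟨_, hT.not, rfl⟩
  un φ := ⟨_, Split.left (.right φ), rfl⟩
  left hR s hs := prodClass_left (t := t) (fun hR => ⟨_, Split.left hR, rfl⟩)
    (fun x hx => ⟨hx.1, fun h => not_lt.1 fun h' => hx.2.2 s hs ⟨h', h.trans hx.2.1⟩⟩) hR
  right hR s hs := prodClass_right (t := t') (fun hR => ⟨_, Split.right hR, rfl⟩)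
    (fun x hx => ⟨hx.2.1, fun h => not_lt.1 fun h' => hx.2.2 s hs ⟨hx.1.trans h, h'⟩⟩) hR
  proj := by
    rintro _ ⟨T, hT, rfl⟩
    refine ((Reduced.bin hT.exists_dec t t').and (Reduced.forall_mem 𝒯 fun s _ =>
      ((Reduced.lt t s).and (Reduced.lt s t')).not)).congr fun f v => ?_
    constructor
    · rintro ⟨⟨-, r, h1, h2, h3⟩, h4⟩
      exact ⟨r, ⟨h1, h2, h4⟩, h3⟩
    · rintro ⟨r, ⟨h1, h2, h4⟩, h3⟩
      exact ⟨⟨h1.trans h2, r, h1, h2, h3⟩, h4⟩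

lemma region_above (𝒯 : Finset (ℕ × ℤ)) (t : ℕ × ℤ) : Region 𝒯
    (fun B => ∃ R, Dec R ∧ B = fun x => R x.sig (tval x.val t) x.pt)
    (fun x => tval x.val t < x.pt ∧ ∀ s ∈ 𝒯, tval x.val s ≤ tval x.val t) where
  and := by
    rintro _ _ ⟨R, hR, rfl⟩ ⟨S, hS, rfl⟩
    exact ⟨_, hR.and hS, rfl⟩
  not := by
    rintro _ ⟨R, hR, rfl⟩
    exact ⟨_, hR.not, rfl⟩
  un φ := ⟨_, .right φ, rfl⟩
  left hR s hs := prodClass_left (t := t) (fun hR => ⟨_, hR, rfl⟩)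
    (fun x hx => ⟨hx.1, fun _ => hx.2 s hs⟩) hR
  right hR s hs := (ProdClass.base ⟨_, .const False, rfl⟩ ⟨_, .const True, rfl⟩).congr
    fun x hx => by
      have := (hx.2 s hs).trans_lt hx.1
      simp [this.le]
  proj := by
    rintro _ ⟨R, hR, rfl⟩
    refine ((Reduced.of_definable hR.exists_right t).and (Reduced.forall_mem 𝒯 fun s _ =>
      Reduced.le s t)).congr fun f v => ?_
    rw [← exists_and_right]
    exact exists_congr fun r => by tauto

lemma region_below (𝒯 : Finset (ℕ × ℤ)) (t : ℕ × ℤ) : Region 𝒯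
    (fun B => ∃ R, Dec R ∧ B = fun x => R x.sig x.pt (tval x.val t))
    (fun x => x.pt < tval x.val t ∧ ∀ s ∈ 𝒯, tval x.val t ≤ tval x.val s) where
  and := by
    rintro _ _ ⟨R, hR, rfl⟩ ⟨S, hS, rfl⟩
    exact ⟨_, hR.and hS, rfl⟩
  not := by
    rintro _ ⟨R, hR, rfl⟩
    exact ⟨_, hR.not, rfl⟩
  un φ := ⟨_, .left φ, rfl⟩
  left hR s hs := (ProdClass.base ⟨_, .const False, rfl⟩ ⟨_, .const True, rfl⟩).congr
    fun x hx => by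
      have := hx.1.trans_le (hx.2 s hs)
      simp [this.le]
  right hR s hs := prodClass_right (t := t) (fun hR => ⟨_, hR, rfl⟩)
    (fun x hx => ⟨hx.1, fun _ => hx.2 s hs⟩) hR
  proj := by
    rintro _ ⟨R, hR, rfl⟩
    refine ((Reduced.of_definable hR.exists_left t).and (Reduced.forall_mem 𝒯 fun s _ =>
      Reduced.le t s)).congr fun f v => ?_
    rw [← exists_and_right]
    exact exists_congr fun r => by tauto

end Regions

lemma exists_region {ι : Type*} (s : Finset ι) (hs : s.Nonempty) (g : ι → ℝ) (r : ℝ) :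
    (∃ i ∈ s, r = g i) ∨
    (∃ i ∈ s, ∃ j ∈ s, g i < r ∧ r < g j ∧ ∀ k ∈ s, ¬ (g i < g k ∧ g k < g j)) ∨
    (∃ i ∈ s, g i < r ∧ ∀ k ∈ s, g k ≤ g i) ∨ ∃ i ∈ s, r < g i ∧ ∀ k ∈ s, g i ≤ g k := by
  classical
  by_cases heq : ∃ i ∈ s, r = g i
  · exact Or.inl heq
  right
  have hne : ∀ k ∈ s, g k < r ∨ r < g k := fun k hk =>
    lt_or_gt_of_ne fun h => heq ⟨k, hk, h.symm⟩
  have hlow : (∃ i ∈ s, g i < r ∧ ∀ k ∈ s, g k < r → g k ≤ g i) ∨ ∀ k ∈ s, r < g k := by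
    by_cases h : (s.filter fun i => g i < r).Nonempty
    · obtain ⟨i, hi, hmax⟩ := Finset.exists_max_image _ g h
      rw [Finset.mem_filter] at hi
      exact Or.inl ⟨i, hi.1, hi.2, fun k hk hkr => hmax k (Finset.mem_filter.2 ⟨hk, hkr⟩)⟩
    · refine Or.inr fun k hk => (hne k hk).resolve_left fun h' => h ⟨k, ?_⟩
      exact Finset.mem_filter.2 ⟨hk, h'⟩
  have hhigh : (∃ i ∈ s, r < g i ∧ ∀ k ∈ s, r < g k → g i ≤ g k) ∨ ∀ k ∈ s, g k < r := by
    by_cases h : (s.filter fun i => r < g i).Nonempty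
    · obtain ⟨i, hi, hmin⟩ := Finset.exists_min_image _ g h
      rw [Finset.mem_filter] at hi
      exact Or.inl ⟨i, hi.1, hi.2, fun k hk hkr => hmin k (Finset.mem_filter.2 ⟨hk, hkr⟩)⟩
    · refine Or.inr fun k hk => (hne k hk).resolve_right fun h' => h ⟨k, ?_⟩
      exact Finset.mem_filter.2 ⟨hk, h'⟩
  rcases hlow with ⟨i, hi, hir, hmax⟩ | hlow <;> rcases hhigh with ⟨j, hj, hjr, hmin⟩ | hhigh
  · refine Or.inl ⟨i, hi, j, hj, hir, hjr, fun k hk => ?_⟩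
    rintro ⟨h1, h2⟩
    rcases hne k hk with h | h
    · exact h1.not_ge (hmax k hk h)
    · exact h2.not_ge (hmin k hk h)
  · exact Or.inr (Or.inl ⟨i, hi, hir, fun k hk => hmax k hk (hhigh k hk)⟩)
  · exact Or.inr (Or.inr ⟨j, hj, hjr, fun k hk => hmin k hk (hlow k hk)⟩)
  · obtain ⟨k, hk⟩ := hs
    exact absurd (hlow k hk) (hhigh k hk).not_gt

/-- Reduced properties are closed under quantification. -/
lemma Reduced.exists {Φ : Sig → (ℕ → ℝ) → Prop} (hΦ : Reduced Φ) (y : ℕ) :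
    Reduced (fun f v => ∃ r, Φ f (Function.update v y r)) := by
  obtain ⟨𝒯₀, h₀⟩ := hΦ.separate y
  set 𝒯 := insert (0, 0) 𝒯₀
  have hsub : 𝒯₀ ⊆ 𝒯 := Finset.subset_insert _ _
  have d1 := Reduced.exists_mem 𝒯 fun t _ => hΦ.subst y t
  have d2 := Reduced.exists_mem 𝒯 fun t _ => Reduced.exists_mem 𝒯 fun t' _ =>
    (region_between 𝒯 t t').projection (h₀ _ _ ((region_between 𝒯 t t').mono hsub))
  have d3 := Reduced.exists_mem 𝒯 fun t _ =>
    (region_above 𝒯 t).projection (h₀ _ _ ((region_above 𝒯 t).mono hsub))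
  have d4 := Reduced.exists_mem 𝒯 fun t _ =>
    (region_below 𝒯 t).projection (h₀ _ _ ((region_below 𝒯 t).mono hsub))
  refine (d1.or (d2.or (d3.or d4))).congr fun f v => ?_
  constructor
  · rintro (⟨t, -, h⟩ | ⟨t, -, t', -, r, -, h⟩ | ⟨t, -, r, -, h⟩ | ⟨t, -, r, -, h⟩)
    exacts [⟨_, h⟩, ⟨r, h⟩, ⟨r, h⟩, ⟨r, h⟩]
  · rintro ⟨r, h⟩
    rcases exists_region 𝒯 ⟨_, Finset.mem_insert_self _ _⟩ (tval v) r with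
      ⟨t, ht, rfl⟩ | ⟨t, ht, t', ht', h1⟩ | ⟨t, ht, h1⟩ | ⟨t, ht, h1⟩
    · exact Or.inl ⟨t, ht, h⟩
    · exact Or.inr (Or.inl ⟨t, ht, t', ht', r, h1, h⟩)
    · exact Or.inr (Or.inr (Or.inl ⟨t, ht, r, h1, h⟩))
    · exact Or.inr (Or.inr (Or.inr ⟨t, ht, r, h1, h⟩))

lemma exists_tval_eq (t : Term intZ) : ∃ t' : ℕ × ℤ, ∀ v, Term.val v t = tval v t' := by
  obtain ⟨i, c, hc⟩ := t
  obtain ⟨n, rfl⟩ := AddSubgroup.mem_zmultiples_iff.1 hc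
  exact ⟨(i, n), fun v => by simp [Term.val, tval]⟩

lemma FO.reduced (φ : FO intZ ℕ) : Reduced (fun f v => φ.sat f v) := by
  induction φ with
  | tt => exact .const True
  | atom p t =>
    obtain ⟨t', h⟩ := exists_tval_eq t
    exact (Reduced.un (.atom p) t').congr fun f v => by simp [FO.sat, MTLC.sat, h]
  | lt s t =>
    obtain ⟨s', h⟩ := exists_tval_eq s
    obtain ⟨t', h'⟩ := exists_tval_eq t
    exact (Reduced.lt s' t').congr fun f v => by simp [FO.sat, h, h']
  | conj φ ψ ih1 ih2 => exact ih1.and ih2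
  | neg φ ih => exact ih.not
  | ex x φ ih => exact ih.exists x

/-- Every `FO_ℤ` formula is equivalent to an `MTL_ℤ+C` formula. -/
theorem FO.exists_mtlc (φ : FO intZ ℕ) : ∃ ψ : MTLC intZ ℕ, EquivFOMTLC φ ψ := by
  obtain ⟨ψ, h⟩ := φ.reduced.definable
  exact ⟨ψ, fun f r => (h f r).symm⟩

/-! ### Translating `PQ2MLO` into `FO_ℤ` -/

/-- The constant `1` of `FO_ℤ`. -/
def oneZ : intZ := ⟨1, AddSubgroup.mem_zmultiples 1⟩

/-- The translation of `PQ2MLO` formulas to `FO_ℤ`. -/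
def PQ.toFO : PQ P → FO intZ P
  | tt => .tt
  | atom p x => .atom p (x, 0)
  | lt x y => .lt (x, 0) (y, 0)
  | conj φ ψ => .conj φ.toFO ψ.toFO
  | neg φ => .neg φ.toFO
  | ex x φ => .ex x φ.toFO
  | exFutI x y ψ => .ex y (.conj (.conj (.lt (x, 0) (y, 0)) (.lt (y, 0) (x, oneZ))) ψ.toFO)
  | exPastI x y ψ => .ex y (.conj (.conj (.lt (x, -oneZ) (y, 0)) (.lt (y, 0) (x, 0))) ψ.toFO)
  | exFutP x y χ => .ex y (.conj (.conj (.neg (.lt (y, 0) (x, oneZ)))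
      (.neg (.lt (x, oneZ) (y, 0)))) χ.toFO)
  | exPastP x y χ => .ex y (.conj (.conj (.neg (.lt (y, 0) (x, -oneZ)))
      (.neg (.lt (x, -oneZ) (y, 0)))) χ.toFO)

lemma PQ.sat_toFO {f : ℝ → Set P} {π : PQ P} (h : π.WF) (v : ℕ → ℝ) :
    π.toFO.sat f v ↔ π.sat f v := by
  induction π generalizing v with
  | tt => exact Iff.rfl
  | atom p x => simp [toFO, FO.sat, PQ.sat, Term.val]
  | lt x y => simp [toFO, FO.sat, PQ.sat, Term.val]
  | conj φ ψ ih1 ih2 => exact and_congr (ih1 h.1 v) (ih2 h.2 v)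
  | neg φ ih => exact not_congr (ih h v)
  | ex x φ ih => exact exists_congr fun r => ih h _
  | exFutI x y ψ ih =>
    simp only [toFO, FO.sat, PQ.sat, ih h.2.2]
    simp [Term.val, oneZ, Function.update_of_ne h.1, and_assoc]
  | exPastI x y ψ ih =>
    simp only [toFO, FO.sat, PQ.sat, ih h.2.2]
    simp [Term.val, oneZ, Function.update_of_ne h.1, and_assoc, sub_eq_add_neg]
  | exFutP x y ψ ih =>
    simp only [toFO, FO.sat, PQ.sat, ih h.2.2]
    simp [Term.val, oneZ, Function.update_of_ne h.1, ← le_antisymm_iff, eq_comm]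
  | exPastP x y ψ ih =>
    simp only [toFO, FO.sat, PQ.sat, ih h.2.2]
    simp [Term.val, oneZ, Function.update_of_ne h.1, ← le_antisymm_iff, ← sub_eq_add_neg,
      -tsub_le_iff_right, eq_comm]

lemma PQ.free_toFO {π : PQ P} (h : π.WF) : π.toFO.free = π.free := by
  induction π with
  | tt | atom | lt => rfl
  | conj φ ψ ih1 ih2 => simp [toFO, FO.free, PQ.free, ih1 h.1, ih2 h.2]
  | neg φ ih => exact ih h
  | ex x φ ih => simp [toFO, FO.free, PQ.free, ih h]
  | exFutI x y ψ ih | exPastI x y ψ ih | exFutP x y ψ ih | exPastP x y ψ ih =>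
    simp only [toFO, FO.free, PQ.free, ih h.2.2]
    have := h.1
    ext z
    simp only [Set.mem_sdiff, Set.mem_union, Set.mem_insert_iff, Set.mem_singleton_iff]
    grind

/-! ### Translating `MTL_ℤ+C` into `PQ2MLO` -/

/-- Properties of points expressed by `PQ2MLO` formulas with one free variable. -/
def PQDef (X : Sig → ℝ → Prop) : Prop :=
  ∀ x, ∃ π : PQ ℕ, π.WF ∧ π.free = {x} ∧ ∀ f v, π.sat f v ↔ X f (v x)

/-- Relations between points expressed by `PQ2MLO` formulas with two free variables. -/
def PQDef₂ (R : BRel) : Prop :=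
  ∀ x y, x ≠ y → ∃ π : PQ ℕ, π.WF ∧ π.free = {x, y} ∧ ∀ f v, π.sat f v ↔ R f (v x) (v y)

section PQDef
variable {X Y : Sig → ℝ → Prop} {R S : BRel}

namespace PQDef

lemma congr (h : PQDef X) (h' : ∀ f r, X f r ↔ Y f r) : PQDef Y :=
  (funext fun f => funext fun r => propext (h' f r) : X = Y) ▸ h

lemma top : PQDef fun _ _ => True := fun x =>
  ⟨.neg (.lt x x), trivial, by simp [PQ.free], fun f v => by simp [PQ.sat]⟩

lemma not (h : PQDef X) : PQDef fun f r => ¬ X f r := fun x => by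
  obtain ⟨π, h1, h2, h3⟩ := h x
  exact ⟨.neg π, h1, h2, fun f v => not_congr (h3 f v)⟩

lemma and (h : PQDef X) (h' : PQDef Y) : PQDef fun f r => X f r ∧ Y f r := fun x => by
  obtain ⟨π, h1, h2, h3⟩ := h x
  obtain ⟨π', h1', h2', h3'⟩ := h' x
  exact ⟨.conj π π', ⟨h1, h1'⟩, by simp [PQ.free, h2, h2'],
    fun f v => and_congr (h3 f v) (h3' f v)⟩

lemma or (h : PQDef X) (h' : PQDef Y) : PQDef fun f r => X f r ∨ Y f r :=
  (h.not.and h'.not).not.congr fun f r => by tauto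

lemma add_one (h : PQDef X) : PQDef fun f r => X f (r + 1) := fun x => by
  obtain ⟨π, h1, h2, h3⟩ := h (x + 1)
  exact ⟨.exFutP x (x + 1) π, ⟨by simp, h2, h1⟩, by simp [PQ.free, h2],
    fun f v => by simp [PQ.sat, h3]⟩

lemma sub_one (h : PQDef X) : PQDef fun f r => X f (r - 1) := fun x => by
  obtain ⟨π, h1, h2, h3⟩ := h (x + 1)
  exact ⟨.exPastP x (x + 1) π, ⟨by simp, h2, h1⟩, by simp [PQ.free, h2],
    fun f v => by simp [PQ.sat, h3]⟩

lemma left (h : PQDef X) : PQDef₂ fun f a _ => X f a := fun x y _ => by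
  obtain ⟨π, h1, h2, h3⟩ := h x
  exact ⟨.conj π (.neg (.lt y y)), ⟨h1, trivial⟩, by simp [PQ.free, h2, Set.pair_comm y x],
    fun f v => by simp [PQ.sat, h3]⟩

lemma right (h : PQDef X) : PQDef₂ fun f _ b => X f b := fun x y _ => by
  obtain ⟨π, h1, h2, h3⟩ := h y
  refine ⟨.conj (.neg (.lt x x)) π, ⟨trivial, h1⟩, ?_, fun f v => by simp [PQ.sat, h3]⟩
  simp [PQ.free, h2, Set.pair_comm y x]

end PQDef

namespace PQDef₂

lemma congr (h : PQDef₂ R) (h' : ∀ f a b, R f a b ↔ S f a b) : PQDef₂ S :=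
  (funext fun f => funext fun a => funext fun b => propext (h' f a b) : R = S) ▸ h

lemma lt : PQDef₂ fun _ a b => a < b := fun x y _ =>
  ⟨.lt x y, trivial, rfl, fun _ _ => Iff.rfl⟩

lemma swap (h : PQDef₂ R) : PQDef₂ fun f a b => R f b a := fun x y hxy => by
  obtain ⟨π, h1, h2, h3⟩ := h y x hxy.symm
  exact ⟨π, h1, by rw [h2, Set.pair_comm], h3⟩

lemma not (h : PQDef₂ R) : PQDef₂ fun f a b => ¬ R f a b := fun x y hxy => by
  obtain ⟨π, h1, h2, h3⟩ := h x y hxy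
  exact ⟨.neg π, h1, h2, fun f v => not_congr (h3 f v)⟩

lemma and (h : PQDef₂ R) (h' : PQDef₂ S) : PQDef₂ fun f a b => R f a b ∧ S f a b :=
  fun x y hxy => by
    obtain ⟨π, h1, h2, h3⟩ := h x y hxy
    obtain ⟨π', h1', h2', h3'⟩ := h' x y hxy
    exact ⟨.conj π π', ⟨h1, h1'⟩, by simp [PQ.free, h2, h2'],
      fun f v => and_congr (h3 f v) (h3' f v)⟩

lemma comp (h : PQDef₂ R) (h' : PQDef₂ S) : PQDef₂ fun f a b => ∃ z, R f a z ∧ S f z b :=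
  fun x y hxy => by
    have hx : x ≠ x + y + 1 := by omega
    have hy : y ≠ x + y + 1 := by omega
    obtain ⟨π, h1, h2, h3⟩ := h x (x + y + 1) hx
    obtain ⟨π', h1', h2', h3'⟩ := h' (x + y + 1) y hy.symm
    refine ⟨.ex (x + y + 1) (.conj π π'), ⟨h1, h1'⟩, ?_, fun f v => ?_⟩
    · simp only [PQ.free, h2, h2']
      ext z
      simp only [Set.mem_sdiff, Set.mem_union, Set.mem_insert_iff, Set.mem_singleton_iff]
      omega
    · simp [PQ.sat, h3, h3', Function.update_of_ne hx, Function.update_of_ne hy]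

lemma cat (h : PQDef₂ R) (h' : PQDef₂ S) :
    PQDef₂ fun f a b => ∃ z, a < z ∧ z < b ∧ R f a z ∧ S f z b :=
  ((lt.and h).comp (lt.and h')).congr fun f a b => exists_congr fun z => by tauto

lemma all (h : PQDef X) : PQDef₂ fun f a b => ∀ u, a < u → u < b → X f u :=
  (h.not.right.cat PQDef.top.right).not.congr fun f a b => by push Not; simp

lemma exists_right (h : PQDef₂ R) : PQDef fun f a => ∃ b, a < b ∧ R f a b := fun x => by
  obtain ⟨π, h1, h2, h3⟩ := (lt.and h) x (x + 1) (by simp)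
  exact ⟨.ex (x + 1) π, h1, by simp [PQ.free, h2], fun f v => by simp [PQ.sat, h3]⟩

lemma exists_left (h : PQDef₂ R) : PQDef fun f b => ∃ a, a < b ∧ R f a b := fun x => by
  obtain ⟨π, h1, h2, h3⟩ := (lt.and h).swap x (x + 1) (by simp)
  exact ⟨.ex (x + 1) π, h1, by simp [PQ.free, h2], fun f v => by simp [PQ.sat, h3]⟩

lemma exists_right_one (h : PQDef₂ R) : PQDef fun f a => ∃ b, a < b ∧ b < a + 1 ∧ R f a b :=
  fun x => by
    obtain ⟨π, h1, h2, h3⟩ := h x (x + 1) (by simp)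
    exact ⟨.exFutI x (x + 1) π, ⟨by simp, h2, h1⟩, by simp [PQ.free, h2],
      fun f v => by simp [PQ.sat, h3]⟩

lemma exists_left_one (h : PQDef₂ R) : PQDef fun f b => ∃ a, b - 1 < a ∧ a < b ∧ R f a b :=
  fun x => by
    obtain ⟨π, h1, h2, h3⟩ := h.swap x (x + 1) (by simp)
    exact ⟨.exPastI x (x + 1) π, ⟨by simp, h2, h1⟩, by simp [PQ.free, h2],
      fun f v => by simp [PQ.sat, h3]⟩

lemma inc_replicate {F : Fm} (h : PQDef fun f r => F.sat f r) (n : ℕ) :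
    PQDef₂ fun f a b => Inc f (List.replicate n F) a b := by
  induction n with
  | zero => exact PQDef.top.left
  | succ n ih => exact h.right.cat ih

end PQDef₂

end PQDef

/-- Sets of positive distances which are finite unions of integer points, unit intervals and
rays. -/
inductive IntegralDist : (ℝ → Prop) → Prop
  | empty : IntegralDist fun _ => False
  | unit : IntegralDist fun d => d < 1
  | one : IntegralDist fun d => d = 1
  | pos : IntegralDist fun _ => True
  | add_one {J : ℝ → Prop} : IntegralDist J → IntegralDist fun d => 1 < d ∧ J (d - 1)
  | or {J J' : ℝ → Prop} : IntegralDist J → IntegralDist J' → IntegralDist fun d => J d ∨ J' d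
  | congr {J J' : ℝ → Prop} : IntegralDist J → (∀ d, 0 < d → (J d ↔ J' d)) → IntegralDist J'

namespace IntegralDist
variable {J : ℝ → Prop}

lemma and_const (h : IntegralDist J) (p : Prop) : IntegralDist fun d => J d ∧ p := by
  by_cases hp : p
  · simpa [hp] using h
  · simpa [hp] using empty

lemma add_nat (h : IntegralDist J) (n : ℕ) : IntegralDist fun d => n < d ∧ J (d - n) := by
  induction n with
  | zero => exact h.congr fun d hd => by simp [hd]
  | succ n ih =>
    refine ih.add_one.congr fun d _ => ?_
    have hn : (0 : ℝ) ≤ n := n.cast_nonneg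
    push_cast
    rw [show d - 1 - (n : ℝ) = d - (n + 1) by ring]
    constructor
    · rintro ⟨-, h1, h2⟩
      exact ⟨by linarith, h2⟩
    · rintro ⟨h1, h2⟩
      exact ⟨by linarith, by linarith, h2⟩

lemma exists_lt (n : ℕ) {Z : ℕ → ℝ → Prop} (h : ∀ m, IntegralDist (Z m)) :
    IntegralDist fun d => ∃ m < n, Z m d := by
  induction n with
  | zero => simpa using empty
  | succ n ih =>
    refine (ih.or (h n)).congr fun d _ => ?_
    simp only [Nat.lt_succ_iff_lt_or_eq, or_and_right, exists_or, exists_eq_left]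

lemma exists_nat_of_mem {x : ℝ} (hx : x ∈ intZ) (h0 : 0 ≤ x) : ∃ n : ℕ, x = n := by
  obtain ⟨m, rfl⟩ := AddSubgroup.mem_zmultiples_iff.1 hx
  simp only [zsmul_eq_mul, mul_one] at h0 ⊢
  obtain ⟨n, rfl⟩ := Int.eq_ofNat_of_zero_le (show 0 ≤ m by exact_mod_cast h0)
  exact ⟨n, by simp⟩

/-- Intervals with integer endpoints are constant on open unit intervals. -/
lemma mem_iff_of_unit (I : MTLI intZ) {m : ℕ} {d d' : ℝ} (h1 : m < d) (h2 : d < m + 1)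
    (h1' : m < d') (h2' : d' < m + 1) : I.mem d → I.mem d' := by
  have key : ∀ n : ℕ, (n : ℝ) < m + 1 → (n : ℝ) ≤ m := fun n h => by
    have : n < m + 1 := by exact_mod_cast h
    exact_mod_cast Nat.lt_succ_iff.1 this
  have key' : ∀ n : ℕ, (m : ℝ) < n → (m : ℝ) + 1 ≤ n := fun n h => by
    have : m < n := by exact_mod_cast h
    exact_mod_cast this
  rintro ⟨h3, h4⟩
  constructor
  · obtain ⟨n, hn⟩ := exists_nat_of_mem I.lo_mem I.lo_nonneg
    have : (n : ℝ) ≤ m := key n (by split_ifs at h3 <;> linarith)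
    split_ifs <;> linarith
  · intro b hb
    obtain ⟨n, hn⟩ := exists_nat_of_mem (I.hi_mem b hb).1 (I.hi_mem b hb).2
    have h5 := h4 b hb
    have : (m : ℝ) + 1 ≤ n := key' n (by split_ifs at h5 <;> linarith)
    split_ifs <;> linarith

lemma mem_mtli (I : MTLI intZ) : IntegralDist I.mem := by
  have hpt : ∀ m : ℕ, IntegralDist fun d => d = m + 1 := fun m =>
    (one.add_nat m).congr fun d _ =>
      ⟨fun h => by linarith [h.2], fun h => ⟨by linarith, by linarith⟩⟩
  have hun : ∀ m : ℕ, IntegralDist fun d => m < d ∧ d < m + 1 := fun m =>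
    (unit.add_nat m).congr fun d _ => and_congr_right fun _ => by
      rw [sub_lt_iff_lt_add, add_comm]
  have hpiece : ∀ n : ℕ, IntegralDist fun d => ∃ m < n, ((m < d ∧ d < m + 1) ∧
      I.mem (m + 1 / 2)) ∨ (d = m + 1 ∧ I.mem (m + 1)) := fun n =>
    exists_lt n fun m => ((hun m).and_const _).or ((hpt m).and_const _)
  have hmem : ∀ n : ℕ, ∀ d : ℝ, 0 < d → d ≤ n → ((∃ m < n, ((m < d ∧ d < m + 1) ∧
      I.mem (m + 1 / 2)) ∨ (d = m + 1 ∧ I.mem (m + 1))) ↔ I.mem d) := by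
    intro n d hd hdn
    constructor
    · rintro ⟨m, -, ⟨⟨h1, h2⟩, h3⟩ | ⟨rfl, h3⟩⟩
      · exact mem_iff_of_unit I (by linarith) (by linarith) h1 h2 h3
      · exact h3
    · intro h
      obtain ⟨m, hm⟩ : ∃ m, ⌈d⌉₊ = m + 1 :=
        Nat.exists_eq_succ_of_ne_zero (Nat.ceil_pos.2 hd).ne'
      have h1 : (m : ℝ) < d := Nat.lt_ceil.1 (by omega)
      have h2 : d ≤ m + 1 := by
        have := Nat.le_ceil d
        rw [hm] at this
        exact_mod_cast this
      have h3 : m < n := by exact_mod_cast h1.trans_le hdn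
      rcases h2.lt_or_eq with h4 | h4
      · exact ⟨m, h3, Or.inl ⟨⟨h1, h4⟩, mem_iff_of_unit I h1 h4 (by linarith)
          (by linarith) h⟩⟩
      · exact ⟨m, h3, Or.inr ⟨h4, h4 ▸ h⟩⟩
  rcases hhi : I.hi with _ | b
  · obtain ⟨n, hn⟩ := exists_nat_of_mem I.lo_mem I.lo_nonneg
    refine (((hpiece n).or (pos.add_nat n))).congr fun d hd => ?_
    have hgt : (n : ℝ) < d → I.mem d := fun h =>
      ⟨by split_ifs <;> linarith, fun b hb => by simp [hhi] at hb⟩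
    constructor
    · rintro (⟨m, h1, h2⟩ | ⟨h1, -⟩)
      · rcases le_or_gt d n with h3 | h3
        · exact (hmem n d hd h3).1 ⟨m, h1, h2⟩
        · exact hgt h3
      · exact hgt h1
    · intro h
      rcases le_or_gt d n with h3 | h3
      · exact Or.inl ((hmem n d hd h3).2 h)
      · exact Or.inr ⟨h3, trivial⟩
  · obtain ⟨n, hn⟩ := exists_nat_of_mem (I.hi_mem b hhi).1 (I.hi_mem b hhi).2
    refine (hpiece n).congr fun d hd => ?_
    constructor
    · rintro ⟨m, h1, h2⟩
      refine (hmem n d hd ?_).1 ⟨m, h1, h2⟩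
      have h3 : (m : ℝ) + 1 ≤ n := by exact_mod_cast h1
      rcases h2 with ⟨⟨-, h2⟩, -⟩ | ⟨h2, -⟩ <;> linarith
    · intro h
      refine (hmem n d hd ?_).2 h
      have h3 := h.2 b hhi
      split_ifs at h3 <;> linarith

lemma pqDef_until (hJ : IntegralDist J) {X Y : Sig → ℝ → Prop} (hX : PQDef X)
    (hY : PQDef Y) : PQDef fun f r =>
      ∃ t, r < t ∧ J (t - r) ∧ X f t ∧ ∀ u, r < u → u < t → Y f u := by
  have hR : PQDef₂ fun f a b => X f b ∧ ∀ u, a < u → u < b → Y f u :=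
    hX.right.and (PQDef₂.all hY)
  have hfull : PQDef fun f r => ∀ u, r < u → u < r + 1 → Y f u :=
    hY.not.right.exists_right_one.not.congr fun f r => by push Not; exact Iff.rfl
  induction hJ with
  | empty => exact PQDef.top.not.congr fun f r => by simp
  | unit =>
    refine hR.exists_right_one.congr fun f r => exists_congr fun t => ?_
    beta_reduce
    rw [sub_lt_iff_lt_add']
  | one =>
    refine (hX.add_one.and hfull).congr fun f r => ?_
    constructor
    · rintro ⟨h1, h2⟩
      exact ⟨r + 1, by linarith, by ring, h1, h2⟩
    · rintro ⟨t, -, h1, h2⟩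
      rwa [show t = r + 1 by linarith] at h2
  | pos => exact hR.exists_right.congr fun f r => exists_congr fun t => by simp
  | @add_one J _ ih =>
    refine (hfull.and (hY.add_one.and ih.add_one)).congr fun f r => ?_
    constructor
    · rintro ⟨h1, h2, t, h3, h4, h5, h6⟩
      refine ⟨t, by linarith, ⟨by linarith, by rwa [sub_sub]⟩, h5, fun u hu hu' => ?_⟩
      rcases lt_trichotomy u (r + 1) with h | rfl | h
      exacts [h1 u hu h, h2, h6 u h hu']
    · rintro ⟨t, h1, ⟨h2, h3⟩, h4, h5⟩
      exact ⟨fun u hu hu' => h5 u hu (by linarith), h5 _ (by linarith) (by linarith), t,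
        by linarith, by rwa [← sub_sub], h4, fun u hu hu' => h5 u (by linarith) hu'⟩
  | or _ _ ih1 ih2 =>
    refine (ih1.or ih2).congr fun f r => ?_
    simp only [← exists_or, ← and_or_left, ← or_and_right]
  | congr _ h ih =>
    refine ih.congr fun f r => exists_congr fun t => and_congr_right fun hrt => ?_
    rw [h _ (sub_pos.2 hrt)]

lemma pqDef_since (hJ : IntegralDist J) {X Y : Sig → ℝ → Prop} (hX : PQDef X)
    (hY : PQDef Y) : PQDef fun f r =>
      ∃ t, t < r ∧ J (r - t) ∧ X f t ∧ ∀ u, t < u → u < r → Y f u := by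
  have hR : PQDef₂ fun f a b => X f a ∧ ∀ u, a < u → u < b → Y f u :=
    hX.left.and (PQDef₂.all hY)
  have hfull : PQDef fun f r => ∀ u, r - 1 < u → u < r → Y f u :=
    hY.not.left.exists_left_one.not.congr fun f r => by push Not; exact Iff.rfl
  induction hJ with
  | empty => exact PQDef.top.not.congr fun f r => by simp
  | unit =>
    refine hR.exists_left_one.congr fun f r => exists_congr fun t => ?_
    beta_reduce
    rw [sub_lt_comm, and_left_comm]
  | one =>
    refine (hX.sub_one.and hfull).congr fun f r => ?_
    constructor
    · rintro ⟨h1, h2⟩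
      exact ⟨r - 1, by linarith, by ring, h1, h2⟩
    · rintro ⟨t, -, h1, h2⟩
      rwa [show t = r - 1 by linarith] at h2
  | pos => exact hR.exists_left.congr fun f r => exists_congr fun t => by simp
  | @add_one J _ ih =>
    refine (hfull.and (hY.sub_one.and ih.sub_one)).congr fun f r => ?_
    constructor
    · rintro ⟨h1, h2, t, h3, h4, h5, h6⟩
      refine ⟨t, by linarith, ⟨by linarith, by rwa [sub_right_comm]⟩, h5, fun u hu hu' => ?_⟩
      rcases lt_trichotomy u (r - 1) with h | rfl | h
      exacts [h6 u hu h, h2, h1 u h hu']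
    · rintro ⟨t, h1, ⟨h2, h3⟩, h4, h5⟩
      exact ⟨fun u hu hu' => h5 u (by linarith) hu', h5 _ (by linarith) (by linarith), t,
        by linarith, by rwa [sub_right_comm], h4, fun u hu hu' => h5 u hu (by linarith)⟩
  | or _ _ ih1 ih2 =>
    refine (ih1.or ih2).congr fun f r => ?_
    simp only [← exists_or, ← and_or_left, ← or_and_right]
  | congr _ h ih =>
    refine ih.congr fun f r => exists_congr fun t => and_congr_right fun hrt => ?_
    rw [h _ (sub_pos.2 hrt)]

end IntegralDist

lemma inc_append_singleton_iff {f : Sig} {F : Fm} {l : List Fm} {a b : ℝ} :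
    Inc f (l ++ [F]) a b ↔ ∃ y, a < y ∧ y < b ∧ Inc f l a y ∧ F.sat f y := by
  constructor
  · intro h
    induction l generalizing a with
    | nil =>
      obtain ⟨z, h1, h2, h3, -⟩ := h
      exact ⟨z, h1, h2, trivial, h3⟩
    | cons G l ih =>
      obtain ⟨z, h1, h2, h3, h4⟩ := h
      obtain ⟨y, h5, h6, h7, h8⟩ := ih h4
      exact ⟨y, h1.trans h5, h6, ⟨z, h1, h5, h3, h7⟩, h8⟩
  · rintro ⟨y, h1, h2, h3, h4⟩
    exact h3.append_singleton h1 h4 h2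

lemma MTLC.pqDef (φ : Fm) : PQDef fun f r => φ.sat f r := by
  induction φ with
  | tt => exact PQDef.top
  | atom p => exact fun x => ⟨.atom p x, trivial, rfl, fun _ _ => Iff.rfl⟩
  | conj φ ψ ih1 ih2 => exact ih1.and ih2
  | neg φ ih => exact ih.not
  | untl φ ψ I ih1 ih2 => exact (IntegralDist.mem_mtli I).pqDef_until ih2 ih1
  | sinc φ ψ I ih1 ih2 => exact (IntegralDist.mem_mtli I).pqDef_since ih2 ih1
  | fcount n φ ih =>
    cases n with
    | zero => exact PQDef.top.congr fun f r => by simp [MTLC.sat, Subsingleton.strictMono]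
    | succ n =>
      refine ((PQDef₂.inc_replicate ih n).and ih.right).exists_right_one.congr fun f r => ?_
      rw [← inc_append_singleton_iff, ← List.replicate_succ', inc_replicate_iff]
      exact Iff.rfl
  | pcount n φ ih =>
    cases n with
    | zero => exact PQDef.top.congr fun f r => by simp [MTLC.sat, Subsingleton.strictMono]
    | succ n =>
      refine (ih.left.and (PQDef₂.inc_replicate ih n)).exists_left_one.congr fun f r => ?_
      exact inc_replicate_iff (n := n + 1)

/-- Every `MTL_ℤ+C` formula is equivalent to a `PQ2MLO` formula. -/
theorem MTLC.exists_pq (ψ : MTLC intZ ℕ) :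
    ∃ π : PQ ℕ, π.WF ∧ π.free ⊆ {0} ∧ EquivPQMTLC π ψ := by
  obtain ⟨π, h1, h2, h3⟩ := ψ.pqDef 0
  exact ⟨π, h1, h2.subset, fun f r => h3 f _⟩

/-- Every `PQ2MLO` formula is equivalent to an `FO_ℤ` formula. -/
theorem PQ.exists_fo {π : PQ ℕ} (h : π.WF) (hfree : π.free ⊆ {0}) :
    ∃ φ : FO intZ ℕ, φ.free ⊆ {0} ∧ EquivFOPQ φ π :=
  ⟨π.toFO, (PQ.free_toFO h).trans_subset hfree, fun _ _ => PQ.sat_toFO h _⟩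

/-- **Theorem 4.** `FO_ℤ`, PQ2MLO and `MTL_ℤ+C` all have the same expressive power: for
formulas with one free variable, each of the three formalisms can express exactly the same
properties of signals. -/
theorem fo_pq2mlo_mtlc_same_expressive_power :
    (∀ φ : FO intZ ℕ, φ.free ⊆ {0} → ∃ π : PQ ℕ, π.WF ∧ π.free ⊆ {0} ∧ EquivFOPQ φ π) ∧
    (∀ π : PQ ℕ, π.WF → π.free ⊆ {0} → ∃ φ : FO intZ ℕ, φ.free ⊆ {0} ∧ EquivFOPQ φ π) ∧
    (∀ π : PQ ℕ, π.WF → π.free ⊆ {0} → ∃ ψ : MTLC intZ ℕ, EquivPQMTLC π ψ) ∧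
    (∀ ψ : MTLC intZ ℕ, ∃ π : PQ ℕ, π.WF ∧ π.free ⊆ {0} ∧ EquivPQMTLC π ψ) ∧
    (∀ φ : FO intZ ℕ, φ.free ⊆ {0} → ∃ ψ : MTLC intZ ℕ, EquivFOMTLC φ ψ) ∧
    (∀ ψ : MTLC intZ ℕ, ∃ φ : FO intZ ℕ, φ.free ⊆ {0} ∧ EquivFOMTLC φ ψ) := by
  refine ⟨fun φ _ => ?_, fun π h h' => PQ.exists_fo h h', fun π h h' => ?_,
    fun ψ => ψ.exists_pq, fun φ _ => φ.exists_mtlc, fun ψ => ?_⟩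
  · obtain ⟨ψ, hψ⟩ := φ.exists_mtlc
    obtain ⟨π, h1, h2, h3⟩ := ψ.exists_pq
    exact ⟨π, h1, h2, fun f r => (hψ f r).trans (h3 f r).symm⟩
  · obtain ⟨φ, -, hφ⟩ := PQ.exists_fo h h'
    obtain ⟨ψ, hψ⟩ := φ.exists_mtlc
    exact ⟨ψ, fun f r => (hφ f r).symm.trans (hψ f r)⟩
  · obtain ⟨π, h1, h2, h3⟩ := ψ.exists_pq
    obtain ⟨φ, h4, h5⟩ := PQ.exists_fo h1 h2
    exact ⟨φ, h4, fun f r => (h5 f r).trans (h3 f r)⟩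

end MTLPaper
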